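/- arXiv:1801.04636 — 4 statements merged into one kernel-verified Lean document; each statement's English description precedes it below -/
import Mathlib

section
/- Let (K, 𝒫, ψ) be a C^s regular Cantor set with s > 1, and for m ≥ 1 let 𝒫^m denote the collection of connected components of ψ^{-(m-1)}(I_j), for I_j ∈ 𝒫. Suppose J ∈ 𝒫^m is such that 𝒫^m \ {J} is still a Markov partition for the expanding map ψ^m. Then the Cantor set K̃ = ⋂_{n≥0} ψ^{-nm}(⋃_{I ∈ 𝒫^m, I ≠ J} I) satisfies dimH(K̃) < dimH(K), where dimH denotes Hausdorff dimension. -/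
/-- A (candidate) regular Cantor set datum: a finite collection of pairwise disjoint
compact intervals `[a j, b j]`, together with an expanding map `ψ` defined on an open
neighbourhood `U` of their union, whose image of each interval is the convex hull of a
union of intervals of the collection. -/
structure CantorSystem (r : ℕ) where
  a : Fin r → ℝ
  b : Fin r → ℝ
  lt : ∀ j, a j < b j
  disj : ∀ i j, i ≠ j → Disjoint (Set.Icc (a i) (b i)) (Set.Icc (a j) (b j))
  U : Set ℝ
  openU : IsOpen U
  subU : ∀ j, Set.Icc (a j) (b j) ⊆ U
  ψ : ℝ → ℝ
  expand : ∀ x ∈ U, 1 < |deriv ψ x|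
  markov : ∀ j, ∃ T : Finset (Fin r), T.Nonempty ∧
    ψ '' Set.Icc (a j) (b j) = convexHull ℝ (⋃ t ∈ T, Set.Icc (a t) (b t))

namespace CantorSystem

variable {r : ℕ}

/-- The union of the intervals of the Markov partition. -/
def Iset (S : CantorSystem r) : Set ℝ := ⋃ j, Set.Icc (S.a j) (S.b j)

/-- The maximal invariant set `K = ⋂ₙ ψ⁻ⁿ(⋃ⱼ Iⱼ)`. -/
def K (S : CantorSystem r) : Set ℝ := ⋂ n : ℕ, (S.ψ)^[n] ⁻¹' S.Iset

/-- Regularity: the endpoints of each interval belong to `K`, and for each `j` and every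
sufficiently large `l`, `ψ^l(K ∩ Iⱼ) = K`. -/
def Regular (S : CantorSystem r) : Prop :=
  (∀ j, S.a j ∈ S.K ∧ S.b j ∈ S.K) ∧
  ∀ j, ∃ l₀ : ℕ, ∀ l ≥ l₀, (S.ψ)^[l] '' (S.K ∩ Set.Icc (S.a j) (S.b j)) = S.K

/-- The collection `𝒫^m`: the connected components of the sets `ψ^{-(m-1)}(Iⱼ)`
(within the set of points whose iterates up to time `m-1` stay in the union of the
intervals, i.e. where `ψ^{m-1}` is legitimately defined). -/
def refined (S : CantorSystem r) (m : ℕ) : Set (Set ℝ) :=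
  {J | ∃ j : Fin r, ∃ x,
    x ∈ (⋂ i : Fin m, (S.ψ)^[(i : ℕ)] ⁻¹' S.Iset) ∩
        (S.ψ)^[m - 1] ⁻¹' Set.Icc (S.a j) (S.b j) ∧
    J = connectedComponentIn
        ((⋂ i : Fin m, (S.ψ)^[(i : ℕ)] ⁻¹' S.Iset) ∩
          (S.ψ)^[m - 1] ⁻¹' Set.Icc (S.a j) (S.b j)) x}

end CantorSystem

/-- A finite collection of pairwise disjoint compact intervals is a Markov partition for a
map `ψ` if the image of each interval of the collection is the convex hull of a union of
intervals of the collection. -/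
def IsMarkovPartition (ψ : ℝ → ℝ) (P : Set (Set ℝ)) : Prop :=
  P.Finite ∧
  (∀ I ∈ P, ∃ x y : ℝ, x < y ∧ I = Set.Icc x y) ∧
  (P.Pairwise fun A B => Disjoint A B) ∧
  ∀ I ∈ P, ∃ Q ⊆ P, Q.Nonempty ∧ ψ '' I = convexHull ℝ (⋃₀ Q)

section HausdorffBounds

open MeasureTheory Metric Set Filter Topology
open scoped NNReal ENNReal

/-- If `B` contains separated expanding-controlled copies `φ i '' B` of itself with ratios `c i`
satisfying `1 ≤ ∑ c i ^ t`, then every finite cover of `B` has `t`-content bounded below. -/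
theorem le_sum_ediam_rpow_of_finite_cover {X ι κ : Type*} [PseudoEMetricSpace X] [Fintype ι]
    [Nontrivial ι] {B : Set X} (hB : B.Nonempty) {φ : ι → X → X}
    (hφ : ∀ i, MapsTo (φ i) B B) {c : ι → ℝ≥0∞}
    (hc : ∀ i, ∀ x ∈ B, ∀ y ∈ B, c i * edist x y ≤ edist (φ i x) (φ i y))
    {δ : ℝ≥0∞} (hsep : ∀ i j, i ≠ j → ∀ x ∈ B, ∀ y ∈ B, δ ≤ edist (φ i x) (φ j y))
    {t : ℝ} (ht : 0 ≤ t) (hsum : 1 ≤ ∑ i, c i ^ t) (s : Finset κ) (U : κ → Set X)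
    (hU : B ⊆ ⋃ k ∈ s, U k) : δ ^ t ≤ ∑ k ∈ s, ediam (U k) ^ t := by
  classical
  induction hn : s.card using Nat.strong_induction_on generalizing s U with
  | _ n ih =>
  subst hn
  by_cases hbig : ∃ k ∈ s, δ ≤ ediam (U k)
  · obtain ⟨k, hk, hδ⟩ := hbig
    exact (ENNReal.rpow_le_rpow hδ ht).trans
      (Finset.single_le_sum (f := fun k => ediam (U k) ^ t) (fun _ _ => zero_le) hk)
  push Not at hbig
  set p : ι → Finset κ := fun i => s.filter fun k => (U k ∩ φ i '' B).Nonempty with hp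
  have hpd : ∀ i j, i ≠ j → Disjoint (p i) (p j) := by
    intro i j hij
    rw [Finset.disjoint_left]
    intro k hki hkj
    simp only [hp, Finset.mem_filter] at hki hkj
    obtain ⟨hks, _, hx, x, hxB, rfl⟩ := hki
    obtain ⟨_, _, hy, y, hyB, rfl⟩ := hkj
    exact (hbig k hks).not_ge ((hsep i j hij x hxB y hyB).trans (edist_le_ediam_of_mem hx hy))
  have hpcov : ∀ i, B ⊆ ⋃ k ∈ p i, (B ∩ φ i ⁻¹' U k) := by
    intro i x hx
    obtain ⟨k, hk, hxk⟩ := mem_iUnion₂.1 (hU (hφ i hx))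
    exact mem_iUnion₂.2 ⟨k, Finset.mem_filter.2 ⟨hk, _, hxk, x, hx, rfl⟩, hx, hxk⟩
  have hpne : ∀ i, (p i).Nonempty := by
    intro i
    obtain ⟨x, hx⟩ := hB
    obtain ⟨k, hk, -⟩ := mem_iUnion₂.1 (hpcov i hx)
    exact ⟨k, hk⟩
  have hplt : ∀ i, (p i).card < s.card := by
    intro i
    obtain ⟨j, hj⟩ := exists_ne i
    obtain ⟨k, hk⟩ := hpne j
    refine Finset.card_lt_card ⟨Finset.filter_subset _ _, fun h => ?_⟩
    exact Finset.disjoint_left.1 (hpd j i hj) hk (h (Finset.mem_filter.1 hk).1)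
  have hstep : ∀ i, c i ^ t * δ ^ t ≤ ∑ k ∈ p i, ediam (U k) ^ t := by
    intro i
    calc c i ^ t * δ ^ t ≤ c i ^ t * ∑ k ∈ p i, ediam (B ∩ φ i ⁻¹' U k) ^ t := by
          gcongr
          exact ih _ (hplt i) (p i) _ (hpcov i) rfl
      _ = ∑ k ∈ p i, (c i * ediam (B ∩ φ i ⁻¹' U k)) ^ t := by
          rw [Finset.mul_sum]
          exact Finset.sum_congr rfl fun k _ => (ENNReal.mul_rpow_of_nonneg _ _ ht).symm
      _ ≤ _ := by
          refine Finset.sum_le_sum fun k _ => ENNReal.rpow_le_rpow ?_ ht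
          simp only [ediam, ENNReal.mul_iSup]
          refine iSup₂_le fun x hx => iSup₂_le fun y hy => ?_
          exact (hc i x hx.1 y hy.1).trans (edist_le_ediam_of_mem hx.2 hy.2)
  calc δ ^ t = 1 * δ ^ t := (one_mul _).symm
    _ ≤ (∑ i, c i ^ t) * δ ^ t := by gcongr
    _ = ∑ i, c i ^ t * δ ^ t := Finset.sum_mul _ _ _
    _ ≤ ∑ i, ∑ k ∈ p i, ediam (U k) ^ t := Finset.sum_le_sum fun i _ => hstep i
    _ = ∑ k ∈ Finset.univ.biUnion p, ediam (U k) ^ t :=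
        (Finset.sum_biUnion fun i _ j _ hij => hpd i j hij).symm
    _ ≤ _ := Finset.sum_le_sum_of_subset
        (Finset.biUnion_subset.2 fun i _ => Finset.filter_subset _ _)

/-- A set can be enlarged to an open set without increasing much the power of its diameter. -/
theorem exists_isOpen_ediam_rpow_lt {X : Type*} [PseudoEMetricSpace X] (s : Set X) {t : ℝ}
    (ht : 0 < t) {ε : ℝ≥0∞} (hε : ε ≠ 0) (hs : ediam s ≠ ∞) :
    ∃ V, IsOpen V ∧ s ⊆ V ∧ ediam V ^ t ≤ ediam s ^ t + ε := by
  have hlim : Tendsto (fun η : ℝ≥0 => (ediam s + 2 * (η : ℝ≥0∞)) ^ t) (𝓝 0)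
      (𝓝 ((ediam s + 2 * ((0 : ℝ≥0) : ℝ≥0∞)) ^ t)) := by
    refine (ENNReal.continuous_rpow_const.tendsto _).comp (Tendsto.const_add _ ?_)
    exact ENNReal.Tendsto.const_mul ((ENNReal.continuous_coe.tendsto _)) (Or.inr (by simp))
  have hlt : (ediam s + 2 * ((0 : ℝ≥0) : ℝ≥0∞)) ^ t < ediam s ^ t + ε := by
    simpa using ENNReal.lt_add_right (ENNReal.rpow_ne_top_of_nonneg ht.le hs) hε
  have hev := (hlim.eventually (gt_mem_nhds hlt)).filter_mono
    (nhdsWithin_le_nhds (s := Set.Ioi (0 : ℝ≥0)))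
  obtain ⟨η, hη, hη0⟩ := (hev.and self_mem_nhdsWithin).exists
  exact ⟨thickening η s, isOpen_thickening, self_subset_thickening (by exact_mod_cast hη0) s,
    (ENNReal.rpow_le_rpow (ediam_thickening_le η) ht.le).trans hη.le⟩

/-- If all finite covers of a compact set have `t`-content bounded below then its Hausdorff
dimension is at least `t`. -/
theorem IsCompact.le_dimH_of_le_sum_ediam {X : Type*} [EMetricSpace X] {B : Set X}
    (hB : IsCompact B) {t : ℝ≥0} (ht : 0 < t) {η : ℝ≥0∞} (hη : η ≠ 0)
    (h : ∀ (s : Finset ℕ) (U : ℕ → Set X), B ⊆ ⋃ k ∈ s, U k → η ≤ ∑ k ∈ s, ediam (U k) ^ (t : ℝ)) :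
    (t : ℝ≥0∞) ≤ dimH B := by
  borelize X
  have ht' : (0 : ℝ) < t := by exact_mod_cast ht
  refine le_dimH_of_hausdorffMeasure_ne_zero fun h0 => ?_
  obtain ⟨ε, hε0, hεη⟩ := exists_between (pos_iff_ne_zero.2 hη)
  obtain ⟨w, hw0, hwsum⟩ := ENNReal.exists_pos_sum_of_countable (tsub_pos_of_lt hεη).ne' ℕ
  rw [Measure.hausdorffMeasure_apply] at h0
  have h1 := (iSup₂_le_iff.1 h0.le 1 one_pos).trans_lt hε0
  simp only [iInf_lt_iff] at h1
  obtain ⟨V, hcov, hdiam, hsum⟩ := h1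
  choose O hO hVO hOd using fun n => exists_isOpen_ediam_rpow_lt (V n) ht'
    (ε := w n) (by simpa using (hw0 n).ne') (ne_top_of_le_ne_top ENNReal.one_ne_top (hdiam n))
  obtain ⟨s, hs⟩ := hB.elim_finite_subcover O hO
    (hcov.trans (iUnion_mono fun n => hVO n))
  have hle : ∑ k ∈ s, ediam (O k) ^ (t : ℝ) < η := by
    calc ∑ k ∈ s, ediam (O k) ^ (t : ℝ) ≤ ∑' k, ediam (O k) ^ (t : ℝ) := ENNReal.sum_le_tsum s
      _ ≤ ∑' k, ((⨆ _ : (V k).Nonempty, ediam (V k) ^ (t : ℝ)) + w k) := by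
          refine ENNReal.tsum_le_tsum fun k => (hOd k).trans ?_
          gcongr
          rcases (V k).eq_empty_or_nonempty with hk | hk
          · simp [hk, ht']
          · simp [hk]
      _ = (∑' k, ⨆ _ : (V k).Nonempty, ediam (V k) ^ (t : ℝ)) + ∑' k, (w k : ℝ≥0∞) :=
          ENNReal.tsum_add
      _ < ε + (η - ε) := ENNReal.add_lt_add hsum hwsum
      _ = η := add_tsub_cancel_of_le hεη.le
  exact (h s O hs).not_gt hle

/-- Lower bound for the dimension of a compact set containing finitely many separated images of
itself under maps which contract distances at most by the factors `c i ≤ 1`. -/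
theorem IsCompact.lt_dimH_of_one_lt_sum {X ι : Type*} [MetricSpace X] [Fintype ι]
    {B : Set X} (hB : IsCompact B) (hne : B.Nonempty) {φ : ι → X → X}
    (hφ : ∀ i, MapsTo (φ i) B B) {c : ι → ℝ} (hc0 : ∀ i, 0 < c i) (hc1 : ∀ i, c i ≤ 1)
    (hc : ∀ i, ∀ x ∈ B, ∀ y ∈ B, c i * dist x y ≤ dist (φ i x) (φ i y))
    {δ : ℝ} (hδ : 0 < δ)
    (hsep : ∀ i j, i ≠ j → ∀ x ∈ B, ∀ y ∈ B, δ ≤ dist (φ i x) (φ j y))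
    {t : ℝ≥0} (hsum : 1 < ∑ i, c i ^ (t : ℝ)) : (t : ℝ≥0∞) < dimH B := by
  have hcard : Nontrivial ι := by
    by_contra hnt
    rw [not_nontrivial_iff_subsingleton] at hnt
    have h1 : ∑ i, c i ^ (t : ℝ) ≤ Fintype.card ι := by
      calc ∑ i, c i ^ (t : ℝ) ≤ ∑ _i : ι, (1 : ℝ) :=
            Finset.sum_le_sum fun i _ => Real.rpow_le_one (hc0 i).le (hc1 i) t.coe_nonneg
        _ = _ := by simp
    have h2 : (Fintype.card ι : ℝ) ≤ 1 := by
      exact_mod_cast Fintype.card_le_one_iff_subsingleton.2 hnt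
    linarith
  have hcont : Continuous fun u : ℝ≥0 => ∑ i, c i ^ (u : ℝ) :=
    continuous_finsetSum _ fun i _ =>
      (Real.continuous_const_rpow (hc0 i).ne').comp NNReal.continuous_coe
  have hev := (hcont.tendsto t).eventually (lt_mem_nhds hsum)
  obtain ⟨u, hu, htu⟩ := ((hev.filter_mono (nhdsWithin_le_nhds (s := Ioi t))).and
    self_mem_nhdsWithin).exists
  have htu : t < u := htu
  refine lt_of_lt_of_le (by exact_mod_cast htu)
    (hB.le_dimH_of_le_sum_ediam (t := u) (lt_of_le_of_lt zero_le htu)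
      (η := ENNReal.ofReal δ ^ (u : ℝ)) ?_ fun s U hU => ?_)
  · exact (ENNReal.rpow_pos (by simpa using hδ) ENNReal.ofReal_ne_top).ne'
  · refine le_sum_ediam_rpow_of_finite_cover (c := fun i => ENNReal.ofReal (c i)) hne hφ ?_ ?_
      u.coe_nonneg ?_
      s U hU
    · intro i x hx y hy
      rw [edist_dist, edist_dist, ← ENNReal.ofReal_mul (hc0 i).le]
      exact ENNReal.ofReal_le_ofReal (hc i x hx y hy)
    · intro i j hij x hx y hy
      rw [edist_dist]
      exact ENNReal.ofReal_le_ofReal (hsep i j hij x hx y hy)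
    · have : ∑ i, ENNReal.ofReal (c i) ^ (u : ℝ) = ENNReal.ofReal (∑ i, c i ^ (u : ℝ)) := by
        rw [ENNReal.ofReal_sum_of_nonneg fun i _ => Real.rpow_nonneg (hc0 i).le _]
        exact Finset.sum_congr rfl fun i _ => ENNReal.ofReal_rpow_of_pos (hc0 i)
      simp only [this]
      exact ENNReal.one_le_ofReal.2 hu.le

/-- Upper bound for the dimension of a forward invariant set on which an expanding map `g` has
finitely many inverse branches, contracting distances by the factors `c i`. -/
theorem dimH_lt_of_sum_lt_one {X ι : Type*} [MetricSpace X] [Fintype ι] {B : Set X}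
    (hbdd : Bornology.IsBounded B) {g : X → X} (hg : MapsTo g B B) {E : ι → Set X}
    (hE : B ⊆ ⋃ i, E i) {c : ι → ℝ} (hc0 : ∀ i, 0 < c i)
    (hc : ∀ i, ∀ x ∈ E i, ∀ y ∈ E i, dist x y ≤ c i * dist (g x) (g y))
    {ρ : ℝ} (hρ0 : 0 ≤ ρ) (hρ1 : ρ < 1)
    (hρ : ∀ i, ∀ x ∈ E i, ∀ y ∈ E i, dist x y ≤ ρ * dist (g x) (g y))
    {t : ℝ≥0} (ht : 0 < t) (hsum : ∑ i, c i ^ (t : ℝ) < 1) : dimH B < t := by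
  classical
  borelize X
  have hcont : Continuous fun u : ℝ≥0 => ∑ i, c i ^ (u : ℝ) :=
    continuous_finsetSum _ fun i _ =>
      (Real.continuous_const_rpow (hc0 i).ne').comp NNReal.continuous_coe
  have hev := (hcont.tendsto t).eventually (gt_mem_nhds hsum)
  have : (𝓝[<] t).NeBot := nhdsLT_neBot_of_exists_lt ⟨0, ht⟩
  obtain ⟨u, hu, hut⟩ := ((hev.filter_mono (nhdsWithin_le_nhds (s := Iio t))).and
    self_mem_nhdsWithin).exists
  have hut : u < t := hut
  refine lt_of_le_of_lt ?_ (by exact_mod_cast hut : (u : ℝ≥0∞) < t)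
  have hu0 : (0 : ℝ) ≤ u := u.coe_nonneg
  set D := diam B with hD
  have hD0 : 0 ≤ D := diam_nonneg
  set T : (n : ℕ) → (Fin n → ι) → Set X := fun n w =>
    {x | x ∈ B ∧ ∀ i : Fin n, g^[i] x ∈ E (w i)} with hT
  have key : ∀ (b : ι → ℝ), (∀ i, 0 ≤ b i) →
      (∀ i, ∀ x ∈ E i, ∀ y ∈ E i, dist x y ≤ b i * dist (g x) (g y)) → ∀ n w, ∀ x ∈ T n w,
      ∀ y ∈ T n w, dist x y ≤ (∏ i, b (w i)) * dist (g^[n] x) (g^[n] y) := by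
    intro b hb0 hb n
    induction n with
    | zero => intro w x _ y _; simp
    | succ n ih =>
      intro w x hx y hy
      have h1 := ih (fun i => w i.castSucc) x ⟨hx.1, fun i => hx.2 i.castSucc⟩ y
        ⟨hy.1, fun i => hy.2 i.castSucc⟩
      have h2 := hb (w (Fin.last n)) _ (hx.2 (Fin.last n)) _ (hy.2 (Fin.last n))
      rw [Fin.prod_univ_castSucc, mul_assoc, Function.iterate_succ_apply',
        Function.iterate_succ_apply']
      refine h1.trans (mul_le_mul_of_nonneg_left h2 (Finset.prod_nonneg fun i _ => hb0 _))
  have hdist : ∀ n w, ∀ x ∈ T n w, ∀ y ∈ T n w, dist (g^[n] x) (g^[n] y) ≤ D :=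
    fun n w x hx y hy => dist_le_diam_of_mem hbdd (hg.iterate n hx.1) (hg.iterate n hy.1)
  have hprod0 : ∀ n (w : Fin n → ι), 0 ≤ ∏ i, c (w i) :=
    fun n w => Finset.prod_nonneg fun i _ => (hc0 _).le
  have hdiam1 : ∀ n w, ediam (T n w) ≤ ENNReal.ofReal (ρ ^ n * D) := by
    intro n w
    refine ediam_le fun x hx y hy => ?_
    rw [edist_dist]
    refine ENNReal.ofReal_le_ofReal ?_
    have := key (fun _ => ρ) (fun _ => hρ0) hρ n w x hx y hy
    simp only [Finset.prod_const, Finset.card_univ, Fintype.card_fin] at this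
    exact this.trans (mul_le_mul_of_nonneg_left (hdist n w x hx y hy) (pow_nonneg hρ0 n))
  have hdiam2 : ∀ n w, ediam (T n w) ≤ ENNReal.ofReal ((∏ i, c (w i)) * D) := by
    intro n w
    refine ediam_le fun x hx y hy => ?_
    rw [edist_dist]
    refine ENNReal.ofReal_le_ofReal ?_
    exact (key c (fun i => (hc0 i).le) hc n w x hx y hy).trans
      (mul_le_mul_of_nonneg_left (hdist n w x hx y hy) (hprod0 n w))
  have hcov : ∀ n, B ⊆ ⋃ w, T n w := by
    intro n x hx
    have : ∀ i : Fin n, ∃ j, g^[i] x ∈ E j := fun i => mem_iUnion.1 (hE (hg.iterate i hx))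
    choose w hw using this
    exact mem_iUnion.2 ⟨w, hx, hw⟩
  have hr : Tendsto (fun n : ℕ => ENNReal.ofReal (ρ ^ n * D)) atTop (𝓝 0) := by
    have := (tendsto_pow_atTop_nhds_zero_of_lt_one hρ0 hρ1).mul_const D
    rw [zero_mul] at this
    simpa using ENNReal.tendsto_ofReal this
  have hH := Measure.hausdorffMeasure_le_liminf_sum (u : ℝ) B _ hr T
    (Eventually.of_forall hdiam1) (Eventually.of_forall hcov)
  refine dimH_le_of_hausdorffMeasure_ne_top
    (ne_top_of_le_ne_top (ENNReal.ofReal_ne_top (r := D ^ (u : ℝ))) (hH.trans ?_))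
  refine liminf_le_of_le (by isBoundedDefault) fun b hb => ?_
  obtain ⟨n, hn⟩ := hb.exists
  refine hn.trans ?_
  calc ∑ w, ediam (T n w) ^ (u : ℝ)
      ≤ ∑ w : Fin n → ι, ENNReal.ofReal ((∏ i, c (w i) ^ (u : ℝ)) * D ^ (u : ℝ)) := by
        refine Finset.sum_le_sum fun w _ => (ENNReal.rpow_le_rpow (hdiam2 n w) hu0).trans ?_
        rw [ENNReal.ofReal_rpow_of_nonneg (mul_nonneg (hprod0 n w) hD0) hu0,
          Real.mul_rpow (hprod0 n w) hD0, Real.finsetProd_rpow _ _ fun i _ => (hc0 _).le]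
    _ = ENNReal.ofReal ((∑ i, c i ^ (u : ℝ)) ^ n * D ^ (u : ℝ)) := by
        rw [← ENNReal.ofReal_sum_of_nonneg, ← Finset.sum_mul, Fintype.sum_pow]
        intro w _
        exact mul_nonneg (Finset.prod_nonneg fun i _ => Real.rpow_nonneg (hc0 _).le _)
          (Real.rpow_nonneg hD0 _)
    _ ≤ ENNReal.ofReal (D ^ (u : ℝ)) := by
        refine ENNReal.ofReal_le_ofReal (mul_le_of_le_one_left (Real.rpow_nonneg hD0 _) ?_)
        exact pow_le_one₀ (Finset.sum_nonneg fun i _ => Real.rpow_nonneg (hc0 _).le _) hu.le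

end HausdorffBounds

section MarkovMaps

open MeasureTheory Metric Set Filter Topology
open scoped NNReal ENNReal

variable {X A : Type*}

/-- The points whose itinerary with respect to the coding `π` agrees with that of `x` at the
times `0, …, n - 1`. -/
def itineraryCylinder (f : X → X) (π : X → A) (n : ℕ) (x : X) : Set X :=
  {y | ∀ i < n, π (f^[i] y) = π (f^[i] x)}

/-- A mixing expanding map with a Markov coding `π` and distortion bounded by `C`. -/
structure IsMarkovMap [MetricSpace X] (f : X → X) (π : X → A) (Λ C : ℝ) : Prop where
  continuous : Continuous f
  isLocallyConstant : IsLocallyConstant π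
  markov : ∀ x y, π y = π (f x) → ∃ x', π x' = π x ∧ f x' = y
  mixing : ∀ x, ∃ l₀, ∀ l ≥ l₀, ∀ y, ∃ x', π x' = π x ∧ f^[l] x' = y
  one_lt : 1 < Λ
  expand : ∀ x y, π x = π y → Λ * dist x y ≤ dist (f x) (f y)
  one_le : 1 ≤ C
  distortion : ∀ n z, ∀ x ∈ itineraryCylinder f π n z, ∀ y ∈ itineraryCylinder f π n z,
    ∀ x' ∈ itineraryCylinder f π n z, ∀ y' ∈ itineraryCylinder f π n z,
    dist (f^[n] x) (f^[n] y) * dist x' y' ≤ C * (dist (f^[n] x') (f^[n] y') * dist x y)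

section Cylinders

variable {f : X → X} {π : X → A}

theorem mem_itineraryCylinder_self (n : ℕ) (x : X) : x ∈ itineraryCylinder f π n x :=
  fun _ _ => rfl

theorem itineraryCylinder_eq_of_mem {n : ℕ} {x y : X} (h : y ∈ itineraryCylinder f π n x) :
    itineraryCylinder f π n y = itineraryCylinder f π n x := by
  ext u
  exact ⟨fun hu i hi => (hu i hi).trans (h i hi), fun hu i hi => (hu i hi).trans (h i hi).symm⟩

theorem itineraryCylinder_anti {n k : ℕ} (h : n ≤ k) (x : X) :
    itineraryCylinder f π k x ⊆ itineraryCylinder f π n x :=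
  fun _ hy i hi => hy i (hi.trans_le h)

theorem mem_itineraryCylinder_add {n k : ℕ} {x y : X} (h₁ : y ∈ itineraryCylinder f π n x)
    (h₂ : f^[n] y ∈ itineraryCylinder f π k (f^[n] x)) :
    y ∈ itineraryCylinder f π (n + k) x := by
  intro i hi
  rcases lt_or_ge i n with hin | hin
  · exact h₁ i hin
  · obtain ⟨j, rfl⟩ := Nat.exists_eq_add_of_le' hin
    rw [Function.iterate_add_apply, Function.iterate_add_apply]
    exact h₂ j (by omega)

theorem mem_itineraryCylinder_succ {n : ℕ} {x y : X} (h₁ : y ∈ itineraryCylinder f π n x)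
    (h₂ : π (f^[n] y) = π (f^[n] x)) : y ∈ itineraryCylinder f π (n + 1) x :=
  mem_itineraryCylinder_add h₁ fun i hi => by
    obtain rfl : i = 0 := by omega
    exact h₂

end Cylinders

namespace IsMarkovMap

variable [MetricSpace X] {f : X → X} {π : X → A} {Λ C : ℝ}

theorem exists_preimage (h : IsMarkovMap f π Λ C) {n : ℕ} {x y : X} (hy : π y = π (f^[n] x)) :
    ∃ x' ∈ itineraryCylinder f π n x, f^[n] x' = y := by
  induction n generalizing y with
  | zero => exact ⟨y, fun i hi => absurd hi (Nat.not_lt_zero i), rfl⟩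
  | succ n ih =>
    rw [Function.iterate_succ_apply'] at hy
    obtain ⟨y', hy', rfl⟩ := h.markov _ _ hy
    obtain ⟨x', hx', rfl⟩ := ih hy'
    exact ⟨x', mem_itineraryCylinder_succ hx' hy', Function.iterate_succ_apply' _ _ _⟩

theorem pow_mul_dist_le (h : IsMarkovMap f π Λ C) {n : ℕ} {z x y : X}
    (hx : x ∈ itineraryCylinder f π n z) (hy : y ∈ itineraryCylinder f π n z) :
    Λ ^ n * dist x y ≤ dist (f^[n] x) (f^[n] y) := by
  induction n with
  | zero => simp
  | succ n ih =>
    have h1 := ih (itineraryCylinder_anti n.le_succ z hx) (itineraryCylinder_anti n.le_succ z hy)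
    have h2 := h.expand (f^[n] x) (f^[n] y)
      ((hx n n.lt_succ_self).trans (hy n n.lt_succ_self).symm)
    rw [Function.iterate_succ_apply', Function.iterate_succ_apply']
    refine le_trans ?_ h2
    rw [pow_succ', mul_assoc]
    exact mul_le_mul_of_nonneg_left h1 (zero_lt_one.trans h.one_lt).le

theorem isOpen_itineraryCylinder (h : IsMarkovMap f π Λ C) (n : ℕ) (x : X) :
    IsOpen (itineraryCylinder f π n x) := by
  have : itineraryCylinder f π n x =
      ⋂ i ∈ Finset.range n, f^[i] ⁻¹' (π ⁻¹' {π (f^[i] x)}) := by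
    ext y
    simp [itineraryCylinder]
  rw [this]
  exact isOpen_biInter_finset fun i _ =>
    (h.isLocallyConstant.isOpen_fiber _).preimage (h.continuous.iterate i)

theorem exists_ne_of_coding [Nontrivial X] (h : IsMarkovMap f π Λ C) (x : X) :
    ∃ u v, π u = π x ∧ π v = π x ∧ u ≠ v := by
  obtain ⟨y, z, hyz⟩ := exists_pair_ne X
  obtain ⟨l, hl⟩ := h.mixing x
  obtain ⟨u, hu, rfl⟩ := hl l le_rfl y
  obtain ⟨v, hv, rfl⟩ := hl l le_rfl z
  exact ⟨u, v, hu, hv, fun huv => hyz (by rw [huv])⟩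

section Compact

variable [CompactSpace X]

theorem exists_separation (h : IsMarkovMap f π Λ C) (n : ℕ) :
    ∃ δ > 0, ∀ x y, dist x y < δ → y ∈ itineraryCylinder f π n x := by
  obtain ⟨δ, hδ, hball⟩ := lebesgue_number_lemma_of_metric (isCompact_univ (X := X))
    (c := itineraryCylinder f π n) (fun x => h.isOpen_itineraryCylinder n x)
    (fun x _ => mem_iUnion.2 ⟨x, mem_itineraryCylinder_self n x⟩)
  refine ⟨δ, hδ, fun x y hxy => ?_⟩
  obtain ⟨z, hz⟩ := hball x (mem_univ x)
  rw [itineraryCylinder_eq_of_mem (hz (mem_ball_self hδ))]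
  exact hz (mem_ball'.2 hxy)

theorem dist_le_diam_univ (x y : X) : dist x y ≤ diam (univ : Set X) :=
  dist_le_diam_of_mem isCompact_univ.isBounded (mem_univ x) (mem_univ y)

theorem dist_le_diam_itineraryCylinder {n : ℕ} {z x y : X}
    (hx : x ∈ itineraryCylinder f π n z) (hy : y ∈ itineraryCylinder f π n z) :
    dist x y ≤ diam (itineraryCylinder f π n z) :=
  dist_le_diam_of_mem (isCompact_univ.isBounded.subset (subset_univ _)) hx hy

theorem diam_mul_dist_le (h : IsMarkovMap f π Λ C) {n : ℕ} {z x y : X}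
    (hx : x ∈ itineraryCylinder f π n z) (hy : y ∈ itineraryCylinder f π n z) :
    diam (itineraryCylinder f π n z) * dist (f^[n] x) (f^[n] y)
      ≤ C * diam (univ : Set X) * dist x y := by
  have hC : 0 ≤ C := zero_le_one.trans h.one_le
  have hR : 0 ≤ C * diam (univ : Set X) * dist x y :=
    mul_nonneg (mul_nonneg hC diam_nonneg) dist_nonneg
  rcases (dist_nonneg (x := f^[n] x) (y := f^[n] y)).eq_or_lt with h0 | h0
  · rw [← h0, mul_zero]
    exact hR
  · rw [← le_div_iff₀ h0]
    refine diam_le_of_forall_dist_le (div_nonneg hR h0.le) fun x' hx' y' hy' => ?_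
    rw [le_div_iff₀ h0, mul_comm]
    refine (h.distortion n z x hx y hy x' hx' y' hy').trans ?_
    rw [mul_assoc]
    exact mul_le_mul_of_nonneg_left
      (mul_le_mul_of_nonneg_right (dist_le_diam_univ _ _) dist_nonneg) hC

theorem diam_mul_diam_le (h : IsMarkovMap f π Λ C) {n k : ℕ} (hk : 0 < k) (x : X) :
    diam (itineraryCylinder f π n x) * diam (itineraryCylinder f π k (f^[n] x))
      ≤ C * diam (univ : Set X) * diam (itineraryCylinder f π (n + k) x) := by
  have hC : 0 ≤ C := zero_le_one.trans h.one_le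
  have hR : 0 ≤ C * diam (univ : Set X) * diam (itineraryCylinder f π (n + k) x) :=
    mul_nonneg (mul_nonneg hC diam_nonneg) diam_nonneg
  rcases (diam_nonneg (s := itineraryCylinder f π n x)).eq_or_lt with h0 | h0
  · rw [← h0, zero_mul]
    exact hR
  · rw [mul_comm, ← le_div_iff₀ h0]
    refine diam_le_of_forall_dist_le (div_nonneg hR h0.le) fun u hu v hv => ?_
    obtain ⟨u', hu', rfl⟩ := h.exists_preimage (n := n) (x := x) (hu 0 hk)
    obtain ⟨v', hv', rfl⟩ := h.exists_preimage (n := n) (x := x) (hv 0 hk)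
    rw [le_div_iff₀ h0, mul_comm]
    exact (h.diam_mul_dist_le hu' hv').trans (mul_le_mul_of_nonneg_left
      (dist_le_diam_itineraryCylinder (mem_itineraryCylinder_add hu' hu)
        (mem_itineraryCylinder_add hv' hv)) (mul_nonneg hC diam_nonneg))

variable [Nontrivial X]

theorem diam_univ_pos : 0 < diam (univ : Set X) := by
  obtain ⟨x, y, hxy⟩ := exists_pair_ne X
  exact (dist_pos.2 hxy).trans_le (dist_le_diam_univ x y)

theorem diam_itineraryCylinder_pos (h : IsMarkovMap f π Λ C) (n : ℕ) (x : X) :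
    0 < diam (itineraryCylinder f π n x) := by
  obtain ⟨u, v, hu, hv, huv⟩ := h.exists_ne_of_coding (f^[n] x)
  obtain ⟨u', hu', rfl⟩ := h.exists_preimage hu
  obtain ⟨v', hv', rfl⟩ := h.exists_preimage hv
  exact (dist_pos.2 fun e => huv (by rw [e])).trans_le (dist_le_diam_itineraryCylinder hu' hv')

/-- The inverse branches contract distances by a factor comparable to the size of the cylinder. -/
theorem exists_dist_le_diam_mul [Finite A] (h : IsMarkovMap f π Λ C) :
    ∃ c > 0, ∀ n z, ∀ x ∈ itineraryCylinder f π n z, ∀ y ∈ itineraryCylinder f π n z,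
      dist x y ≤ c * diam (itineraryCylinder f π n z) * dist (f^[n] x) (f^[n] y) := by
  have hex : ∀ a : A, ∃ ε > 0, ∀ x, π x = a → ∃ u v, π u = a ∧ π v = a ∧ ε ≤ dist u v := by
    intro a
    by_cases ha : ∃ x, π x = a
    · obtain ⟨x, rfl⟩ := ha
      obtain ⟨u, v, hu, hv, huv⟩ := h.exists_ne_of_coding x
      exact ⟨dist u v, dist_pos.2 huv, fun _ _ => ⟨u, v, hu, hv, le_rfl⟩⟩
    · exact ⟨1, one_pos, fun x hx => absurd ⟨x, hx⟩ ha⟩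
  choose ε hε0 hε using hex
  have : Nonempty A := ⟨π (Classical.arbitrary X)⟩
  obtain ⟨a₀, ha₀⟩ := Finite.exists_min ε
  have hC : 0 < C := zero_lt_one.trans_le h.one_le
  refine ⟨C / ε a₀, div_pos hC (hε0 a₀), fun n z x hx y hy => ?_⟩
  obtain ⟨u, v, hu, hv, huv⟩ := hε (π (f^[n] z)) (f^[n] z) rfl
  obtain ⟨u', hu', rfl⟩ := h.exists_preimage hu
  obtain ⟨v', hv', rfl⟩ := h.exists_preimage hv
  have h1 := h.distortion n z u' hu' v' hv' x hx y hy
  have h2 : ε a₀ * dist x y ≤ C * (dist (f^[n] x) (f^[n] y) * diam (itineraryCylinder f π n z)) :=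
    (mul_le_mul_of_nonneg_right ((ha₀ _).trans huv) dist_nonneg).trans (h1.trans
      (mul_le_mul_of_nonneg_left (mul_le_mul_of_nonneg_left
        (dist_le_diam_itineraryCylinder hu' hv') dist_nonneg) hC.le))
  rw [div_mul_eq_mul_div, div_mul_eq_mul_div, le_div_iff₀ (hε0 a₀)]
  linarith

/-- A finite family of pairwise incomparable loops based at the state `j₀` has total size bounded
in the exponent given by the dimension. -/
theorem sum_returns_le_one (h : IsMarkovMap f π Λ C) {ι : Type*} [Fintype ι] {j₀ : A}
    (z : ι → X) (N : ι → ℕ) (hz : ∀ i, π (z i) = j₀) (hN : ∀ i, π (f^[N i] (z i)) = j₀)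
    (hsep : ∀ i j, i ≠ j → ∃ s ≤ N i, s ≤ N j ∧ π (f^[s] (z i)) ≠ π (f^[s] (z j)))
    {t : ℝ≥0} (hdim : dimH (univ : Set X) ≤ t) :
    ∑ i, (diam (itineraryCylinder f π (N i) (z i)) / (C * diam (univ : Set X))) ^ (t : ℝ) ≤ 1 := by
  by_contra! hlt
  have hC : 0 < C := zero_lt_one.trans_le h.one_le
  have hQ : 0 < C * diam (univ : Set X) := mul_pos hC diam_univ_pos
  set B : Set X := π ⁻¹' {j₀} with hBdef
  have hBc : IsCompact B := (h.isLocallyConstant.isClosed_fiber j₀).isCompact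
  have hne : B.Nonempty := by
    by_contra hne
    have : IsEmpty ι := ⟨fun i => hne ⟨z i, hz i⟩⟩
    simp only [Finset.univ_eq_empty, Finset.sum_empty] at hlt
    linarith
  have hbranch : ∀ i, ∀ y : X, ∃ x', y ∈ B → x' ∈ itineraryCylinder f π (N i) (z i) ∧
      f^[N i] x' = y := by
    intro i y
    by_cases hy : y ∈ B
    · obtain ⟨x', hx', hx''⟩ := h.exists_preimage (n := N i) (x := z i) (y := y)
        ((show π y = j₀ from hy).trans (hN i).symm)
      exact ⟨x', fun _ => ⟨hx', hx''⟩⟩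
    · exact ⟨y, fun hy' => absurd hy' hy⟩
  choose φ hφ using hbranch
  have hφ' : ∀ i, ∀ y ∈ B, φ i y ∈ itineraryCylinder f π (N i + 1) (z i) := by
    intro i y hy
    refine mem_itineraryCylinder_succ (hφ i y hy).1 ?_
    rw [(hφ i y hy).2, hN i]
    exact hy
  obtain ⟨M, hM⟩ := (finite_range N).bddAbove
  obtain ⟨δ, hδ, hδs⟩ := h.exists_separation (M + 1)
  refine (lt_of_lt_of_le (hBc.lt_dimH_of_one_lt_sum hne (φ := φ) (fun i y hy => ?_)
    (fun i => div_pos (h.diam_itineraryCylinder_pos _ _) hQ) (fun i => ?_)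
    (fun i x hx y hy => ?_) hδ (fun i j hij x hx y hy => ?_) hlt)
    ((dimH_mono (subset_univ B)).trans hdim)).false
  · exact (hφ' i y hy 0 (Nat.succ_pos _)).trans (hz i)
  · rw [div_le_one hQ]
    refine (diam_mono (subset_univ _) isCompact_univ.isBounded).trans ?_
    exact le_mul_of_one_le_left diam_nonneg h.one_le
  · rw [div_mul_eq_mul_div, div_le_iff₀ hQ, mul_comm (dist _ _)]
    have := h.diam_mul_dist_le (hφ i x hx).1 (hφ i y hy).1
    rwa [(hφ i x hx).2, (hφ i y hy).2] at this
  · by_contra! hd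
    obtain ⟨s, hsi, hsj, hs⟩ := hsep i j hij
    have h1 := hδs _ _ hd s (Nat.lt_succ_of_le (hsi.trans (hM ⟨i, rfl⟩)))
    rw [hφ' i x hx s (Nat.lt_succ_of_le hsi), hφ' j y hy s (Nat.lt_succ_of_le hsj)] at h1
    exact hs h1.symm

end Compact

end IsMarkovMap

end MarkovMaps

section MarkovMapDimension

open MeasureTheory Metric Set Filter Topology
open scoped NNReal ENNReal

namespace IsMarkovMap

variable {X A : Type*} [MetricSpace X] {f : X → X} {π : X → A} {Λ C : ℝ}

/-- A path from the state of `x₀` to the state of `x` without intermediate visits to the former. -/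
theorem exists_path_from (h : IsMarkovMap f π Λ C) (x₀ x : X) :
    ∃ p a, π p = π x₀ ∧ (∀ s, 0 < s → s < a → π (f^[s] p) ≠ π x₀) ∧ π (f^[a] p) = π x := by
  classical
  obtain ⟨l, hl⟩ := h.mixing x₀
  obtain ⟨z, hz, hzx⟩ := hl l le_rfl x
  set s := Nat.findGreatest (fun s => π (f^[s] z) = π x₀) l with hs
  have hsl : s ≤ l := Nat.findGreatest_le l
  have hs0 : π (f^[s] z) = π x₀ :=
    Nat.findGreatest_spec (P := fun s => π (f^[s] z) = π x₀) (Nat.zero_le l) hz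
  refine ⟨f^[s] z, l - s, hs0, fun u hu0 hu => ?_, ?_⟩
  · rw [← Function.iterate_add_apply]
    exact Nat.findGreatest_is_greatest (P := fun s => π (f^[s] z) = π x₀) (n := l)
      (show Nat.findGreatest _ l < u + s by rw [← hs]; omega) (by omega)
  · rw [← Function.iterate_add_apply, Nat.sub_add_cancel hsl, hzx]

/-- A path from the state of `x` to the state of `x₀` stopped at the first visit. -/
theorem exists_path_to (h : IsMarkovMap f π Λ C) (x₀ x : X) :
    ∃ q b, π q = π x ∧ (∀ s < b, π (f^[s] q) ≠ π x₀) ∧ π (f^[b] q) = π x₀ := by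
  classical
  obtain ⟨l, hl⟩ := h.mixing x
  obtain ⟨z, hz, hzx⟩ := hl l le_rfl x₀
  have hex : ∃ b, π (f^[b] z) = π x₀ := ⟨l, by rw [hzx]⟩
  exact ⟨z, Nat.find hex, hz, fun s hs => Nat.find_min hex hs, Nat.find_spec hex⟩

variable [CompactSpace X]

/-- A first return loop at `j₀` following a prescribed path avoiding `j₀`. -/
theorem exists_first_return (h : IsMarkovMap f π Λ C) {j₀ : A} {p q x : X} {a b n : ℕ}
    (hp : π p = j₀) (hpa : ∀ s, 0 < s → s < a → π (f^[s] p) ≠ j₀) (hpx : π (f^[a] p) = π x)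
    (hx : ∀ s ≤ n, π (f^[s] x) ≠ j₀) (hq : π q = π (f^[n] x))
    (hqb : ∀ s < b, π (f^[s] q) ≠ j₀) (hqj : π (f^[b] q) = j₀) :
    ∃ z, π z = j₀ ∧ π (f^[n + b + a] z) = j₀ ∧
      (∀ s, 0 < s → s < n + b + a → π (f^[s] z) ≠ j₀) ∧
      (∀ s ≤ n, π (f^[s + a] z) = π (f^[s] x)) ∧
      diam (itineraryCylinder f π a p) * diam (itineraryCylinder f π (n + 1) x) *
        diam (itineraryCylinder f π b q) ≤
        (C * diam (univ : Set X)) ^ 2 * diam (itineraryCylinder f π (n + b + a) z) := by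
  obtain ⟨x', hx', hx'q⟩ := h.exists_preimage hq
  have hx'1 : x' ∈ itineraryCylinder f π (n + 1) x :=
    mem_itineraryCylinder_succ hx' (by rw [hx'q, hq])
  have hx'0 : π x' = π x := hx'1 0 (Nat.succ_pos n)
  obtain ⟨z, hz, hzx⟩ := h.exists_preimage (hx'0.trans hpx.symm)
  have hz1 : z ∈ itineraryCylinder f π (a + 1) p :=
    mem_itineraryCylinder_succ hz (by rw [hzx, hpx, hx'0])
  have hzn : ∀ s ≤ n, π (f^[s + a] z) = π (f^[s] x) := by
    intro s hs
    rw [Function.iterate_add_apply, hzx]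
    exact hx'1 s (Nat.lt_succ_of_le hs)
  have hzb : ∀ s, f^[s + n + a] z = f^[s] q := by
    intro s
    rw [Function.iterate_add_apply, hzx, Function.iterate_add_apply, hx'q]
  have hb : 0 < b := by
    rcases Nat.eq_zero_or_pos b with rfl | hb
    · exact absurd (hq.symm.trans hqj) (hx n le_rfl)
    · exact hb
  refine ⟨z, (hz1 0 (Nat.succ_pos a)).trans hp, ?_, ?_, hzn, ?_⟩
  · rw [add_comm n b, hzb b, hqj]
  · intro s hs0 hs
    rcases lt_or_ge s a with hsa | hsa
    · rw [hz s hsa]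
      exact hpa s hs0 hsa
    · obtain ⟨u, rfl⟩ := Nat.exists_eq_add_of_le' hsa
      rcases le_or_gt u n with hun | hun
      · rw [hzn u hun]
        exact hx u hun
      · obtain ⟨v, rfl⟩ := Nat.exists_eq_add_of_le' hun.le
        rw [hzb v]
        exact hqb v (by omega)
  · have hQ : 0 ≤ C * diam (univ : Set X) :=
      mul_nonneg (zero_le_one.trans h.one_le) diam_nonneg
    have h1 := h.diam_mul_diam_le (n := a) (k := n + b) (by omega) z
    have h2 := h.diam_mul_diam_le (n := n) (k := b) hb x'
    rw [hzx, itineraryCylinder_eq_of_mem hz, add_comm a] at h1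
    rw [hx'q, itineraryCylinder_eq_of_mem hx'] at h2
    have h3 : diam (itineraryCylinder f π (n + 1) x) ≤ diam (itineraryCylinder f π n x) :=
      diam_mono (itineraryCylinder_anti n.le_succ x)
        (isCompact_univ.isBounded.subset (subset_univ _))
    calc _ ≤ diam (itineraryCylinder f π a p) * (diam (itineraryCylinder f π n x) *
          diam (itineraryCylinder f π b q)) := by
          rw [mul_assoc]
          exact mul_le_mul_of_nonneg_left (mul_le_mul_of_nonneg_right h3 diam_nonneg) diam_nonneg
      _ ≤ diam (itineraryCylinder f π a p) * (C * diam (univ : Set X) *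
          diam (itineraryCylinder f π (n + b) x')) := mul_le_mul_of_nonneg_left h2 diam_nonneg
      _ = C * diam (univ : Set X) * (diam (itineraryCylinder f π a p) *
          diam (itineraryCylinder f π (n + b) x')) := by ring
      _ ≤ C * diam (univ : Set X) * (C * diam (univ : Set X) *
          diam (itineraryCylinder f π (n + b + a) z)) := mul_le_mul_of_nonneg_left h1 hQ
      _ = _ := by ring

variable [Nontrivial X]

theorem exists_coding_ne (h : IsMarkovMap f π Λ C) : ∃ x y, π x ≠ π y := by
  by_contra! hall
  obtain ⟨x, y, hxy⟩ := exists_pair_ne X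
  have hmem : ∀ n u, u ∈ itineraryCylinder f π n x := fun n u i _ => hall _ _
  have hle : ∀ n : ℕ, Λ ^ n ≤ diam (univ : Set X) / dist x y := by
    intro n
    rw [le_div_iff₀ (dist_pos.2 hxy)]
    exact (h.pow_mul_dist_le (hmem n x) (hmem n y)).trans (dist_le_diam_univ _ _)
  obtain ⟨n, hn⟩ := pow_unbounded_of_one_lt (diam (univ : Set X) / dist x y) h.one_lt
  exact (hle n).not_gt hn

theorem dimH_univ_pos (h : IsMarkovMap f π Λ C) : 0 < dimH (univ : Set X) := by
  by_contra! h0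
  obtain ⟨x, y, hxy⟩ := h.exists_coding_ne
  obtain ⟨lx, hlx⟩ := h.mixing x
  obtain ⟨ly, hly⟩ := h.mixing y
  set l := max lx ly
  have hloop : ∀ u, π u = π x ∨ π u = π y → ∃ z, π z = π x ∧ π (f^[l] z) = π u ∧
      π (f^[l + l] z) = π x := by
    intro u hu
    have : ∃ v, π v = π u ∧ f^[l] v = x := by
      rcases hu with hu | hu <;> rw [hu]
      · exact hlx l (le_max_left _ _) x
      · exact hly l (le_max_right _ _) x
    obtain ⟨v, hv, hvx⟩ := this
    obtain ⟨z, hz, hzv⟩ := hlx l (le_max_left _ _) v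
    exact ⟨z, hz, by rw [hzv, hv], by rw [Function.iterate_add_apply, hzv, hvx]⟩
  obtain ⟨z₁, h₁, h₁', h₁''⟩ := hloop x (Or.inl rfl)
  obtain ⟨z₂, h₂, h₂', h₂''⟩ := hloop y (Or.inr rfl)
  have := h.sum_returns_le_one (ι := Bool) (j₀ := π x) (fun i => cond i z₁ z₂) (fun _ => l + l)
    (by rintro (_ | _) <;> assumption) (by rintro (_ | _) <;> assumption)
    (by
      intro i j hij
      refine ⟨l, by omega, by omega, ?_⟩
      rcases i with _ | _ <;> rcases j with _ | _ <;> simp_all [eq_comm])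
    (t := 0) (by simpa using h0)
  norm_num at this

/-- The words of length `n + 1` from `i` to `j` realized by orbits avoiding `j₀`. -/
def AvoidingWord (f : X → X) (π : X → A) (j₀ : A) (n : ℕ) (ij : A × A) : Type _ :=
  {w : Fin (n + 1) → A // ∃ x, (∀ s : Fin (n + 1), π (f^[s] x) = w s) ∧ (∀ s, w s ≠ j₀) ∧
    π x = ij.1 ∧ π (f^[n] x) = ij.2}

/-- An orbit realizing an avoiding word. -/
noncomputable def AvoidingWord.point {j₀ : A} {n : ℕ} {ij : A × A}
    (w : AvoidingWord f π j₀ n ij) : X :=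
  w.2.choose

noncomputable instance [Finite A] (j₀ : A) (n : ℕ) (ij : A × A) :
    Fintype (AvoidingWord f π j₀ n ij) :=
  haveI : Finite (AvoidingWord f π j₀ n ij) :=
    inferInstanceAs (Finite (Subtype _))
  Fintype.ofFinite _

/-- In the exponent given by the dimension, the total size of the words of length `n + 1` avoiding
a given state tends to zero. -/
theorem tendsto_sum_avoidingWord [Finite A] (h : IsMarkovMap f π Λ C) (x₀ : X) (ij : A × A)
    {t : ℝ≥0} (hdim : dimH (univ : Set X) ≤ t) :
    Tendsto (fun n => ∑ w : AvoidingWord f π (π x₀) n ij,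
      diam (itineraryCylinder f π (n + 1) w.point) ^ (t : ℝ)) atTop (𝓝 0) := by
  by_cases hex : ∃ k, Nonempty (AvoidingWord f π (π x₀) k ij)
  swap
  · have : ∀ n, IsEmpty (AvoidingWord f π (π x₀) n ij) :=
      fun n => not_nonempty_iff.1 fun hn => hex ⟨n, hn⟩
    simp
  obtain ⟨k, w₀, x, hxw, hw₀, hxi, hxj⟩ := hex
  have hi : π x ≠ π x₀ := by simpa [← hxw 0] using hw₀ 0
  obtain ⟨p, a, hp, hpa, hpx⟩ := h.exists_path_from x₀ x
  obtain ⟨q, b, hq, hqb, hqj⟩ := h.exists_path_to x₀ (f^[k] x)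
  have hC : 0 < C := zero_lt_one.trans_le h.one_le
  have hQ : 0 < C * diam (univ : Set X) := mul_pos hC diam_univ_pos
  have hz : ∀ (n : ℕ) (_ : AvoidingWord f π (π x₀) n ij), _ := fun n w =>
    h.exists_first_return (x := w.point) (n := n) hp hpa
      (hpx.trans (hxi.trans w.2.choose_spec.2.2.1.symm))
      (fun s hs => by
        have h1 := w.2.choose_spec.1 ⟨s, Nat.lt_succ_of_le hs⟩
        have h2 := w.2.choose_spec.2.1 ⟨s, Nat.lt_succ_of_le hs⟩
        rw [← h1] at h2
        exact h2)
      (hq.trans (hxj.trans w.2.choose_spec.2.2.2.symm)) hqb hqj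
  choose z hz0 hzN hzs hzw hzd using hz
  set κ := diam (itineraryCylinder f π a p) * diam (itineraryCylinder f π b q) /
    (C * diam (univ : Set X)) ^ 3 with hκ
  have hκ0 : 0 < κ := div_pos (mul_pos (h.diam_itineraryCylinder_pos _ _)
    (h.diam_itineraryCylinder_pos _ _)) (pow_pos hQ 3)
  have hbound : ∀ M, ∑ n ∈ Finset.range M, κ ^ (t : ℝ) *
      ∑ w : AvoidingWord f π (π x₀) n ij,
        diam (itineraryCylinder f π (n + 1) w.point) ^ (t : ℝ) ≤ 1 := by
    intro M
    have hsum := h.sum_returns_le_one (j₀ := π x₀)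
      (ι := Σ n : Fin M, AvoidingWord f π (π x₀) n ij)
      (fun u => z u.1 u.2) (fun u => u.1 + b + a) (fun u => hz0 _ _) (fun u => hzN _ _) ?_ hdim
    · refine le_trans ?_ hsum
      rw [Fintype.sum_sigma, ← Fin.sum_univ_eq_sum_range (fun n => κ ^ (t : ℝ) *
        ∑ w : AvoidingWord f π (π x₀) n ij,
          diam (itineraryCylinder f π (n + 1) w.point) ^ (t : ℝ))]
      refine Finset.sum_le_sum fun n _ => ?_
      rw [Finset.mul_sum]
      refine Finset.sum_le_sum fun w _ => ?_
      rw [← Real.mul_rpow hκ0.le diam_nonneg]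
      refine Real.rpow_le_rpow (mul_nonneg hκ0.le diam_nonneg) ?_ t.coe_nonneg
      rw [hκ, div_mul_eq_mul_div, div_le_div_iff₀ (pow_pos hQ 3) hQ]
      have := mul_le_mul_of_nonneg_right (hzd n w) hQ.le
      calc _ = _ := by ring
        _ ≤ _ := this
        _ = _ := by ring
    · have hlt : ∀ (n n' : ℕ) (w : AvoidingWord f π (π x₀) n ij)
          (w' : AvoidingWord f π (π x₀) n' ij), n < n' →
          π (f^[n + b + a] (z n w)) ≠ π (f^[n + b + a] (z n' w')) := by
        intro n n' w w' hn
        rw [hzN]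
        have ha : 0 < a := by
          rcases Nat.eq_zero_or_pos a with rfl | ha
          · exact absurd (hpx.symm.trans hp) hi
          · exact ha
        exact (hzs n' w' _ (by omega) (by omega)).symm
      rintro ⟨⟨n, hn⟩, w⟩ ⟨⟨n', hn'⟩, w'⟩ hne
      rcases lt_trichotomy n n' with hnn | rfl | hnn
      · exact ⟨n + b + a, le_rfl, by simp only; omega, hlt n n' w w' hnn⟩
      · have hww : w.1 ≠ w'.1 := fun e => hne (by rw [Subtype.ext e])
        obtain ⟨s, hs⟩ := Function.ne_iff.1 hww
        have hsn : (s : ℕ) ≤ n := Nat.lt_succ_iff.1 s.2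
        refine ⟨s + a, by simp only; omega, by simp only; omega, ?_⟩
        simp only
        rw [hzw n w s hsn, hzw n w' s hsn]
        rw [← w.2.choose_spec.1 s, ← w'.2.choose_spec.1 s] at hs
        exact hs
      · exact ⟨n' + b + a, by simp only; omega, le_rfl, (hlt n' n w' w hnn).symm⟩
  have hsm := (summable_of_sum_range_le (fun n => mul_nonneg (Real.rpow_nonneg hκ0.le _)
    (Finset.sum_nonneg fun w _ => Real.rpow_nonneg diam_nonneg _)) hbound).tendsto_atTop_zero
  have hκt : κ ^ (t : ℝ) ≠ 0 := (Real.rpow_pos_of_pos hκ0 _).ne'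
  simpa [inv_mul_cancel_left₀ hκt] using hsm.const_mul (κ ^ (t : ℝ))⁻¹

/-- The set of points whose orbit never visits a given state has dimension strictly smaller than
the whole space. -/
theorem dimH_avoiding_lt [Finite A] (h : IsMarkovMap f π Λ C)
    (hfin : dimH (univ : Set X) ≠ ∞) (x₀ : X) :
    dimH {x | ∀ n, π (f^[n] x) ≠ π x₀} < dimH (univ : Set X) := by
  have := Fintype.ofFinite A
  obtain ⟨t, ht⟩ : ∃ t : ℝ≥0, (t : ℝ≥0∞) = dimH (univ : Set X) :=
    ⟨_, ENNReal.coe_toNNReal hfin⟩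
  have ht0 : 0 < t := by
    have := h.dimH_univ_pos
    rw [← ht] at this
    exact_mod_cast this
  obtain ⟨c, hc0, hc⟩ := h.exists_dist_le_diam_mul
  have hlim : Tendsto (fun n => ∑ ij : A × A, ∑ w : AvoidingWord f π (π x₀) n ij,
      (c * diam (itineraryCylinder f π (n + 1) w.point)) ^ (t : ℝ)) atTop (𝓝 0) := by
    have h1 := (tendsto_finsetSum (Finset.univ : Finset (A × A)) fun ij _ =>
      h.tendsto_sum_avoidingWord x₀ ij ht.ge).const_mul (c ^ (t : ℝ))
    simp only [Finset.sum_const_zero, mul_zero, Finset.mul_sum] at h1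
    refine h1.congr fun n => Finset.sum_congr rfl fun ij _ => Finset.sum_congr rfl fun w _ => ?_
    rw [Real.mul_rpow hc0.le diam_nonneg]
  obtain ⟨n, hn⟩ := (hlim.eventually (gt_mem_nhds one_pos)).exists
  rw [← Fintype.sum_sigma (fun u : Σ ij : A × A, AvoidingWord f π (π x₀) n ij =>
    (c * diam (itineraryCylinder f π (n + 1) u.2.point)) ^ (t : ℝ))] at hn
  rw [← ht]
  have hΛ := zero_lt_one.trans h.one_lt
  refine dimH_lt_of_sum_lt_one (g := f^[n + 1]) (ρ := Λ⁻¹)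
    (E := fun u : Σ ij : A × A, AvoidingWord f π (π x₀) n ij =>
      itineraryCylinder f π (n + 1) u.2.point)
    (isCompact_univ.isBounded.subset (subset_univ _)) ?_ ?_
    (fun u => mul_pos hc0 (h.diam_itineraryCylinder_pos _ _)) (fun u x hx y hy => hc _ _ x hx y hy)
    (inv_nonneg.2 hΛ.le) (inv_lt_one_of_one_lt₀ h.one_lt) (fun u x hx y hy => ?_) ht0 hn
  · intro x hx k
    rw [← Function.iterate_add_apply]
    exact hx _
  · intro x hx
    let w : AvoidingWord f π (π x₀) n (π x, π (f^[n] x)) :=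
      ⟨fun s => π (f^[s] x), x, fun _ => rfl, fun s => hx s, rfl, rfl⟩
    refine mem_iUnion.2 ⟨⟨_, w⟩, fun i hi => ?_⟩
    exact (w.2.choose_spec.1 ⟨i, hi⟩).symm
  · rw [inv_mul_eq_div, le_div_iff₀ hΛ, mul_comm]
    refine le_trans (mul_le_mul_of_nonneg_right ?_ dist_nonneg) (h.pow_mul_dist_le hx hy)
    exact le_self_pow₀ h.one_lt.le (Nat.succ_ne_zero n)

end IsMarkovMap

end MarkovMapDimension

section MarkovMapConstructions

open MeasureTheory Metric Set Filter Topology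
open scoped NNReal ENNReal

variable {X A : Type*} {f : X → X} {π : X → A} {Λ C : ℝ}

theorem itineraryCylinder_iterate_subset {m : ℕ} (hm : 0 < m) (n : ℕ) (x : X) :
    itineraryCylinder f^[m] (fun x (i : Fin m) => π (f^[i] x)) n x
      ⊆ itineraryCylinder f π (m * n) x := by
  intro y hy i hi
  have h1 := congrFun (hy (i / m) (Nat.div_lt_of_lt_mul hi)) ⟨i % m, Nat.mod_lt i hm⟩
  simp only [← Function.iterate_mul, ← Function.iterate_add_apply] at h1
  rwa [Nat.mod_add_div] at h1

variable [MetricSpace X]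

/-- Iterates of a Markov map are Markov for the refined coding. -/
theorem IsMarkovMap.iterate (h : IsMarkovMap f π Λ C) {m : ℕ} (hm : 0 < m) :
    IsMarkovMap f^[m] (fun x (i : Fin m) => π (f^[i] x)) Λ C where
  continuous := h.continuous.iterate m
  isLocallyConstant := by
    rw [IsLocallyConstant.iff_isOpen_fiber]
    intro w
    have : (fun x (i : Fin m) => π (f^[i] x)) ⁻¹' {w} = ⋂ i : Fin m, f^[i] ⁻¹' (π ⁻¹' {w i}) := by
      ext x
      simp [funext_iff]
    rw [this]
    exact isOpen_iInter_of_finite fun i =>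
      (h.isLocallyConstant.isOpen_fiber _).preimage (h.continuous.iterate i)
  markov x y hy := by
    obtain ⟨x', hx', hx'y⟩ := h.exists_preimage (n := m) (x := x) (congrFun hy ⟨0, hm⟩)
    exact ⟨x', funext fun i => hx' i i.2, hx'y⟩
  mixing x := by
    obtain ⟨l₀, hl₀⟩ := h.mixing (f^[m] x)
    refine ⟨l₀ + 1, fun l hl y => ?_⟩
    have hml : m + m * (l - 1) = m * l := by
      obtain ⟨k, rfl⟩ : ∃ k, l = k + 1 := ⟨l - 1, by omega⟩
      rw [Nat.add_sub_cancel]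
      ring
    have hle : l₀ ≤ m * (l - 1) := (by omega : l₀ ≤ l - 1).trans (Nat.le_mul_of_pos_left _ hm)
    obtain ⟨u, hu, huy⟩ := hl₀ _ hle y
    obtain ⟨x', hx', rfl⟩ := h.exists_preimage (n := m) (x := x) hu
    refine ⟨x', funext fun i => hx' i i.2, ?_⟩
    rw [← Function.iterate_mul, ← hml, add_comm, Function.iterate_add_apply, huy]
  one_lt := h.one_lt
  expand x y hxy := by
    have hmem : y ∈ itineraryCylinder f π m x := fun i hi => (congrFun hxy ⟨i, hi⟩).symm
    refine le_trans (mul_le_mul_of_nonneg_right ?_ dist_nonneg)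
      (h.pow_mul_dist_le (mem_itineraryCylinder_self m x) hmem)
    exact le_self_pow₀ h.one_lt.le hm.ne'
  one_le := h.one_le
  distortion n z x hx y hy x' hx' y' hy' := by
    rw [← Function.iterate_mul]
    have hs := itineraryCylinder_iterate_subset (f := f) (π := π) hm n z
    exact h.distortion (m * n) z x (hs hx) y (hs hy) x' (hs hx') y' (hs hy')

/-- Bounded distortion for an expanding map whose one-step distortion is controlled by the scale. -/
theorem dist_iterate_mul_dist_le {B D : ℝ} (hΛ : 1 < Λ) (hB : 0 ≤ B) (hD : ∀ x y : X, dist x y ≤ D)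
    (hexp : ∀ x y, π x = π y → Λ * dist x y ≤ dist (f x) (f y))
    (hone : ∀ ρ x y x' y', π y = π x → π x' = π x → π y' = π x →
      dist x y ≤ ρ → dist x x' ≤ ρ → dist x y' ≤ ρ → dist y x' ≤ ρ → dist y y' ≤ ρ →
      dist x' y' ≤ ρ →
      dist (f x) (f y) * dist x' y' ≤ Real.exp (B * ρ) * (dist (f x') (f y') * dist x y))
    (n : ℕ) {z x y x' y' : X} (hx : x ∈ itineraryCylinder f π n z)
    (hy : y ∈ itineraryCylinder f π n z) (hx' : x' ∈ itineraryCylinder f π n z)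
    (hy' : y' ∈ itineraryCylinder f π n z) :
    dist (f^[n] x) (f^[n] y) * dist x' y' ≤
      Real.exp (B * D / (Λ - 1)) * (dist (f^[n] x') (f^[n] y') * dist x y) := by
  have hΛ0 : 0 < Λ := zero_lt_one.trans hΛ
  have hΛ1 : 0 < Λ - 1 := sub_pos.2 hΛ
  have hD0 : 0 ≤ D := dist_nonneg.trans (hD z z)
  have hK : 0 ≤ B * D / (Λ - 1) := div_nonneg (mul_nonneg hB hD0) hΛ1.le
  have hcontr : ∀ n, ∀ z : X, ∀ x ∈ itineraryCylinder f π n z, ∀ y ∈ itineraryCylinder f π n z,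
      Λ ^ n * dist x y ≤ D := by
    intro n
    induction n with
    | zero => intro z x _ y _; simpa using hD x y
    | succ n ih =>
      intro z x hx y hy
      have h1 := ih (f z) (f x) (fun i hi => hx (i + 1) (by omega)) (f y)
        (fun i hi => hy (i + 1) (by omega))
      have h2 := hexp x y ((hx 0 n.succ_pos).trans (hy 0 n.succ_pos).symm)
      rw [pow_succ, mul_assoc]
      exact (mul_le_mul_of_nonneg_left h2 (pow_pos hΛ0 n).le).trans h1
  suffices H : dist (f^[n] x) (f^[n] y) * dist x' y' ≤
      Real.exp (B * D / (Λ - 1) * (1 - (Λ ^ n)⁻¹)) * (dist (f^[n] x') (f^[n] y') * dist x y) by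
    refine H.trans (mul_le_mul_of_nonneg_right (Real.exp_le_exp.2 ?_)
      (mul_nonneg dist_nonneg dist_nonneg))
    exact mul_le_of_le_one_right hK (by linarith [inv_pos.2 (pow_pos hΛ0 n)])
  induction n generalizing z x y x' y' with
  | zero => simp [mul_comm]
  | succ n ih =>
    have ih' := ih (z := f z) (x := f x) (y := f y) (x' := f x') (y' := f y')
      (fun i hi => hx (i + 1) (by omega)) (fun i hi => hy (i + 1) (by omega))
      (fun i hi => hx' (i + 1) (by omega)) (fun i hi => hy' (i + 1) (by omega))
    have hρ : ∀ u ∈ itineraryCylinder f π (n + 1) z, ∀ v ∈ itineraryCylinder f π (n + 1) z,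
        dist u v ≤ D / Λ ^ (n + 1) := fun u hu v hv => by
      rw [le_div_iff₀ (pow_pos hΛ0 _), mul_comm]
      exact hcontr _ z u hu v hv
    have h0 : ∀ u ∈ itineraryCylinder f π (n + 1) z, π u = π z := fun u hu => hu 0 n.succ_pos
    have h1 := hone (D / Λ ^ (n + 1)) x y x' y' ((h0 y hy).trans (h0 x hx).symm)
      ((h0 x' hx').trans (h0 x hx).symm) ((h0 y' hy').trans (h0 x hx).symm)
      (hρ x hx y hy) (hρ x hx x' hx') (hρ x hx y' hy') (hρ y hy x' hx') (hρ y hy y' hy')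
      (hρ x' hx' y' hy')
    have hE : Real.exp (B * D / (Λ - 1) * (1 - (Λ ^ (n + 1))⁻¹)) =
        Real.exp (B * D / (Λ - 1) * (1 - (Λ ^ n)⁻¹)) * Real.exp (B * (D / Λ ^ (n + 1))) := by
      rw [← Real.exp_add]
      congr 1
      field_simp
      ring
    rw [hE]
    simp only [Function.iterate_succ_apply]
    rcases eq_or_ne x' y' with rfl | hne
    · simp
    have hb : 0 < dist (f x') (f y') :=
      (mul_pos hΛ0 (dist_pos.2 hne)).trans_le (hexp x' y' ((h0 x' hx').trans (h0 y' hy').symm))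
    refine le_of_mul_le_mul_left ?_ hb
    set e₁ := Real.exp (B * D / (Λ - 1) * (1 - (Λ ^ n)⁻¹))
    set e₂ := Real.exp (B * (D / Λ ^ (n + 1)))
    have he₁ : 0 ≤ e₁ := (Real.exp_pos _).le
    calc dist (f x') (f y') * (dist (f^[n] (f x)) (f^[n] (f y)) * dist x' y')
        = dist (f^[n] (f x)) (f^[n] (f y)) * dist (f x') (f y') * dist x' y' := by ring
      _ ≤ e₁ * (dist (f^[n] (f x')) (f^[n] (f y')) * dist (f x) (f y)) * dist x' y' :=
          mul_le_mul_of_nonneg_right ih' dist_nonneg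
      _ = e₁ * dist (f^[n] (f x')) (f^[n] (f y')) * (dist (f x) (f y) * dist x' y') := by ring
      _ ≤ e₁ * dist (f^[n] (f x')) (f^[n] (f y')) *
          (e₂ * (dist (f x') (f y') * dist x y)) :=
          mul_le_mul_of_nonneg_left h1 (mul_nonneg he₁ dist_nonneg)
      _ = _ := by ring

end MarkovMapConstructions

section RegularCantorSets

open MeasureTheory Metric Set Filter Topology
open scoped NNReal ENNReal

namespace CantorSystem

variable {r : ℕ} (S : CantorSystem r)

/-- The `j`-th interval of the Markov partition. -/
def interval (j : Fin r) : Set ℝ := Icc (S.a j) (S.b j)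

variable {S}

theorem eq_of_mem_interval {i j : Fin r} {x : ℝ} (hi : x ∈ S.interval i)
    (hj : x ∈ S.interval j) : i = j := by
  by_contra hne
  exact Set.disjoint_left.1 (S.disj i j hne) hi hj

theorem mem_Iset {x : ℝ} : x ∈ S.Iset ↔ ∃ j, x ∈ S.interval j := by
  simp [Iset, interval]

theorem differentiableAt {x : ℝ} (hx : x ∈ S.U) : DifferentiableAt ℝ S.ψ x := by
  by_contra h
  have := S.expand x hx
  rw [deriv_zero_of_not_differentiableAt h] at this
  norm_num at this

theorem continuousOn : ContinuousOn S.ψ S.U :=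
  fun _ hx => (differentiableAt hx).continuousAt.continuousWithinAt

theorem Iset_subset : S.Iset ⊆ S.U := iUnion_subset S.subU

theorem isCompact_Iset : IsCompact S.Iset := isCompact_iUnion fun _ => isCompact_Icc

theorem exists_abs_sub_eq {j : Fin r} {x y : ℝ} (hx : x ∈ S.interval j)
    (hy : y ∈ S.interval j) :
    ∃ ξ ∈ uIcc x y, |S.ψ x - S.ψ y| = |deriv S.ψ ξ| * |x - y| := by
  wlog hxy : x ≤ y generalizing x y
  · obtain ⟨ξ, hξ, h⟩ := this hy hx (le_of_not_ge hxy)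
    exact ⟨ξ, by rwa [uIcc_comm], by rwa [abs_sub_comm, abs_sub_comm x]⟩
  rcases hxy.eq_or_lt with rfl | hlt
  · exact ⟨x, left_mem_uIcc, by simp⟩
  have hsub : Icc x y ⊆ S.U := (Icc_subset_Icc hx.1 hy.2).trans (S.subU j)
  obtain ⟨ξ, hξ, h⟩ := exists_deriv_eq_slope S.ψ hlt (continuousOn.mono hsub)
    fun z hz => (differentiableAt (hsub (Ioo_subset_Icc_self hz))).differentiableWithinAt
  refine ⟨ξ, by rw [uIcc_of_le hxy]; exact Ioo_subset_Icc_self hξ, ?_⟩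
  rw [h, ← abs_mul, abs_sub_comm, ← abs_neg (_ * _)]
  congr 1
  have : y - x ≠ 0 := (sub_pos.2 hlt).ne'
  field_simp
  ring

theorem injOn_interval (j : Fin r) : InjOn S.ψ (S.interval j) := by
  intro x hx y hy hxy
  obtain ⟨ξ, hξ, h⟩ := exists_abs_sub_eq hx hy
  have hξU : ξ ∈ S.U := S.subU j (ordConnected_Icc.uIcc_subset hx hy hξ)
  rw [hxy, sub_self, abs_zero, eq_comm, mul_eq_zero] at h
  rcases h with h | h
  · linarith [S.expand ξ hξU]
  · exact sub_eq_zero.1 (abs_eq_zero.1 h)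

theorem image_uIcc_subset {j : Fin r} {x y : ℝ} (hx : x ∈ S.interval j)
    (hy : y ∈ S.interval j) {z : ℝ} (hz : z ∈ uIcc x y) : S.ψ z ∈ uIcc (S.ψ x) (S.ψ y) := by
  have hsub : uIcc x y ⊆ S.interval j := ordConnected_Icc.uIcc_subset hx hy
  rcases ContinuousOn.strictMonoOn_of_injOn_Icc' (S.lt j).le
    (continuousOn.mono (S.subU j)) (injOn_interval j) with h | h
  · exact (h.monotoneOn.mono hsub).mapsTo_uIcc hz
  · exact (h.antitoneOn.mono hsub).mapsTo_uIcc hz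

/-- The image of an interval of the partition contains every interval that it meets. -/
theorem interval_subset_image {j k : Fin r} {x : ℝ} (hx : x ∈ S.interval j)
    (hk : S.ψ x ∈ S.interval k) : S.interval k ⊆ S.ψ '' S.interval j := by
  obtain ⟨T, -, hT⟩ := S.markov j
  have hsub : (⋃ t ∈ T, S.interval t) ⊆ S.ψ '' S.interval j := by
    rw [interval, hT]
    exact subset_convexHull ℝ _
  have hmem : S.ψ x ∈ convexHull ℝ (⋃ t ∈ T, S.interval t) := by
    unfold interval
    rw [← hT]
    exact mem_image_of_mem _ hx
  have hord : OrdConnected (S.ψ '' S.interval j) := by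
    rw [interval, hT]
    exact (convex_convexHull ℝ _).ordConnected
  by_cases hkT : k ∈ T
  · exact (subset_biUnion_of_mem (u := fun t => S.interval t) hkT).trans hsub
  have hne : ∀ t ∈ T, ∀ u ∈ S.interval t, u < S.a k ∨ S.b k < u := by
    intro t ht u hu
    by_contra! hcon
    exact hkT (eq_of_mem_interval hu (show u ∈ S.interval k from hcon) ▸ ht)
  have hleft : ∃ u ∈ ⋃ t ∈ T, S.interval t, u < S.a k := by
    by_contra! hcon
    have : convexHull ℝ (⋃ t ∈ T, S.interval t) ⊆ Ioi (S.b k) :=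
      convexHull_min (fun u hu => by
        obtain ⟨t, ht, hut⟩ := mem_iUnion₂.1 hu
        exact (hne t ht u hut).resolve_left (hcon u hu).not_gt) (convex_Ioi _)
    exact (this hmem).not_ge hk.2
  have hright : ∃ u ∈ ⋃ t ∈ T, S.interval t, S.b k < u := by
    by_contra! hcon
    have : convexHull ℝ (⋃ t ∈ T, S.interval t) ⊆ Iio (S.a k) :=
      convexHull_min (fun u hu => by
        obtain ⟨t, ht, hut⟩ := mem_iUnion₂.1 hu
        exact (hne t ht u hut).resolve_right (hcon u hu).not_gt) (convex_Iio _)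
    exact (this hmem).not_ge hk.1
  obtain ⟨u, hu, hua⟩ := hleft
  obtain ⟨v, hv, hbv⟩ := hright
  exact (Icc_subset_Icc hua.le hbv.le).trans (hord.out (hsub hu) (hsub hv))

theorem exists_expansion (hψ : ContDiffOn ℝ 1 S.ψ S.U) :
    ∃ Λ > 1, ∀ j, ∀ ξ ∈ S.interval j, Λ ≤ |deriv S.ψ ξ| := by
  have hcont : ContinuousOn (fun ξ => |deriv S.ψ ξ|) S.Iset :=
    ((hψ.continuousOn_deriv_of_isOpen S.openU le_rfl).mono Iset_subset).abs
  rcases S.Iset.eq_empty_or_nonempty with he | hne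
  · exact ⟨2, by norm_num, fun j ξ hξ => absurd (mem_Iset.2 ⟨j, hξ⟩) (he ▸ notMem_empty ξ)⟩
  obtain ⟨ξ₀, hξ₀, hmin⟩ := isCompact_Iset.exists_isMinOn hne hcont
  exact ⟨_, S.expand ξ₀ (Iset_subset hξ₀), fun j ξ hξ => hmin (mem_Iset.2 ⟨j, hξ⟩)⟩

theorem exists_lipschitz_deriv (hψ : ContDiffOn ℝ 2 S.ψ S.U) :
    ∃ L : ℝ≥0, ∀ j, LipschitzOnWith L (deriv S.ψ) (S.interval j) := by
  have hd : ContDiffOn ℝ 1 (deriv S.ψ) S.U :=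
    hψ.deriv_of_isOpen S.openU (by norm_num)
  have hloc : LocallyLipschitzOn S.Iset (deriv S.ψ) := by
    intro x hx
    obtain ⟨L, t, ht, hL⟩ :=
      (hd.contDiffAt (S.openU.mem_nhds (Iset_subset hx))).exists_lipschitzOnWith
    exact ⟨L, t, mem_nhdsWithin_of_mem_nhds ht, hL⟩
  obtain ⟨L, hL⟩ := hloc.exists_lipschitzOnWith_of_compact isCompact_Iset
  exact ⟨L, fun j => hL.mono (subset_iUnion S.interval j)⟩

theorem mapsTo_K : MapsTo S.ψ S.K S.K := by
  intro x hx
  simp only [K, mem_iInter, mem_preimage] at hx ⊢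
  exact fun n => by simpa using hx (n + 1)

theorem K_subset_Iset : S.K ⊆ S.Iset := fun x hx => by
  simpa using mem_iInter.1 hx 0

theorem mem_K_of_map_mem {x : ℝ} (hx : x ∈ S.Iset) (h : S.ψ x ∈ S.K) : x ∈ S.K := by
  simp only [K, mem_iInter, mem_preimage] at h ⊢
  rintro (_ | n)
  · simpa using hx
  · simpa using h n

theorem isCompact_K : IsCompact S.K := by
  have hclosed : ∀ n, IsClosed {x | ∀ i < n + 1, S.ψ^[i] x ∈ S.Iset} := by
    intro n
    induction n with
    | zero => simpa using isCompact_Iset.isClosed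
    | succ n ih =>
      have : {x | ∀ i < n + 1 + 1, S.ψ^[i] x ∈ S.Iset} =
          S.Iset ∩ S.ψ ⁻¹' {x | ∀ i < n + 1, S.ψ^[i] x ∈ S.Iset} := by
        ext x
        refine ⟨fun h => ⟨h 0 (by omega), fun i hi => h (i + 1) (by omega)⟩, ?_⟩
        rintro ⟨h₀, h⟩ (_ | i) hi
        · exact h₀
        · exact h i (by omega)
      rw [this]
      exact (continuousOn.mono Iset_subset).preimage_isClosed_of_isClosed
        isCompact_Iset.isClosed ih
  have hK : S.K = ⋂ n, {x | ∀ i < n + 1, S.ψ^[i] x ∈ S.Iset} := by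
    ext x
    simp only [K, mem_iInter, mem_preimage, mem_ofPred_eq]
    exact ⟨fun h n i _ => h i, fun h n => h n n n.lt_succ_self⟩
  exact isCompact_Iset.of_isClosed_subset (hK ▸ isClosed_iInter hclosed) K_subset_Iset

variable (S) in
/-- The restriction of the expanding map to the Cantor set. -/
def restrictK : S.K → S.K := mapsTo_K.restrict S.ψ S.K S.K

variable (S) in
/-- The index of the interval containing a point of the Cantor set. -/
noncomputable def code (x : S.K) : Fin r := (mem_Iset.1 (K_subset_Iset x.2)).choose

theorem mem_interval_code (x : S.K) : (x : ℝ) ∈ S.interval (S.code x) :=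
  (mem_Iset.1 (K_subset_Iset x.2)).choose_spec

theorem code_eq_iff {x : S.K} {j : Fin r} : S.code x = j ↔ (x : ℝ) ∈ S.interval j :=
  ⟨fun h => h ▸ mem_interval_code x, fun h => eq_of_mem_interval (mem_interval_code x) h⟩

theorem coe_restrictK_iterate (n : ℕ) (x : S.K) : ((S.restrictK^[n] x : S.K) : ℝ) = S.ψ^[n] x := by
  induction n generalizing x with
  | zero => rfl
  | succ n ih => rw [Function.iterate_succ_apply, ih]; rfl

theorem isLocallyConstant_code : IsLocallyConstant S.code := by
  rw [IsLocallyConstant.iff_isOpen_fiber]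
  intro j
  have : S.code ⁻¹' {j} = (⋃ i : {i // i ≠ j}, ((↑) : S.K → ℝ) ⁻¹' S.interval i)ᶜ := by
    ext x
    simp only [mem_preimage, mem_singleton_iff, mem_compl_iff, mem_iUnion, ← code_eq_iff]
    exact ⟨fun h ⟨i, hi⟩ => i.2 (hi.symm.trans h), fun h => by
      by_contra hne
      exact h ⟨⟨_, hne⟩, rfl⟩⟩
  rw [this, isOpen_compl_iff]
  exact isClosed_iUnion_of_finite fun i => isClosed_Icc.preimage continuous_subtype_val

theorem exists_isMarkovMap (hψ : ContDiffOn ℝ 2 S.ψ S.U) (hreg : S.Regular) :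
    ∃ Λ C, IsMarkovMap S.restrictK S.code Λ C := by
  obtain ⟨Λ, hΛ, hexp⟩ := exists_expansion (hψ.of_le (by norm_num))
  obtain ⟨L, hL⟩ := exists_lipschitz_deriv hψ
  have hexpand : ∀ x y : S.K, S.code x = S.code y →
      Λ * dist x y ≤ dist (S.restrictK x) (S.restrictK y) := by
    intro x y hxy
    have hx := mem_interval_code x
    have hy := hxy ▸ mem_interval_code y
    obtain ⟨ξ, hξ, h⟩ := exists_abs_sub_eq hx hy
    change Λ * |(x : ℝ) - y| ≤ |S.ψ x - S.ψ y|
    rw [h]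
    exact mul_le_mul_of_nonneg_right
      (hexp _ ξ (ordConnected_Icc.uIcc_subset hx hy hξ)) (abs_nonneg _)
  have hD : ∀ x y : S.K, dist x y ≤ diam S.K := fun x y =>
    dist_le_diam_of_mem isCompact_K.isBounded x.2 y.2
  refine ⟨Λ, Real.exp (L * diam S.K / (Λ - 1)), ?_⟩
  refine
    { continuous := (continuousOn.mono (K_subset_Iset.trans Iset_subset)).mapsToRestrict mapsTo_K
      isLocallyConstant := isLocallyConstant_code
      markov := ?_
      mixing := ?_
      one_lt := hΛ
      expand := hexpand
      one_le := Real.one_le_exp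
        (div_nonneg (mul_nonneg L.2 diam_nonneg) (sub_pos.2 hΛ).le)
      distortion := ?_ }
  · intro x y hy
    obtain ⟨x', hx', hx'y⟩ := interval_subset_image (mem_interval_code x)
      (mem_interval_code (S.restrictK x)) (hy ▸ mem_interval_code y)
    exact ⟨⟨x', mem_K_of_map_mem (mem_Iset.2 ⟨_, hx'⟩) (hx'y ▸ y.2)⟩, code_eq_iff.2 hx',
      Subtype.ext hx'y⟩
  · intro x
    obtain ⟨l₀, hl₀⟩ := hreg.2 (S.code x)
    refine ⟨l₀, fun l hl y => ?_⟩
    obtain ⟨x', ⟨hx'K, hx'⟩, hx'y⟩ := (hl₀ l hl).ge y.2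
    exact ⟨⟨x', hx'K⟩, code_eq_iff.2 hx', Subtype.ext ((coe_restrictK_iterate l _).trans hx'y)⟩
  · intro n z x hx y hy x' hx' y' hy'
    refine dist_iterate_mul_dist_le hΛ L.2 hD hexpand ?_ n hx hy hx' hy'
    intro ρ x y x' y' hy hx' hy' h₁ h₂ h₃ h₄ h₅ h₆
    have mx := mem_interval_code x
    have my := hy ▸ mem_interval_code y
    have mx' := hx' ▸ mem_interval_code x'
    have my' := hy' ▸ mem_interval_code y'
    obtain ⟨ξ, hξ, h⟩ := exists_abs_sub_eq mx my
    obtain ⟨ξ', hξ', h'⟩ := exists_abs_sub_eq mx' my'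
    have hξj : ξ ∈ S.interval (S.code x) := ordConnected_Icc.uIcc_subset mx my hξ
    have hξj' : ξ' ∈ S.interval (S.code x) := ordConnected_Icc.uIcc_subset mx' my' hξ'
    have hdist : |ξ - ξ'| ≤ ρ := by
      simp only [Subtype.dist_eq, Real.dist_eq, abs_le] at h₁ h₂ h₃ h₄ h₅ h₆ ⊢
      rcases mem_uIcc.1 hξ with h | h <;> rcases mem_uIcc.1 hξ' with h' | h' <;>
        constructor <;> linarith [h.1, h.2, h'.1, h'.2, h₁.1, h₁.2]
    have hρ : 0 ≤ ρ := (abs_nonneg _).trans hdist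
    have hLip : |deriv S.ψ ξ - deriv S.ψ ξ'| ≤ L * ρ :=
      ((hL _).dist_le_mul ξ hξj ξ' hξj').trans (mul_le_mul_of_nonneg_left hdist L.2)
    have hone : 1 < |deriv S.ψ ξ'| := S.expand ξ' (S.subU _ hξj')
    have hquot : |deriv S.ψ ξ| ≤ Real.exp (L * ρ) * |deriv S.ψ ξ'| := by
      have h₁ := abs_sub_abs_le_abs_sub (deriv S.ψ ξ) (deriv S.ψ ξ')
      have h₂ : 0 ≤ L * ρ := mul_nonneg L.2 hρ
      have h₃ := Real.add_one_le_exp (L * ρ)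
      nlinarith
    change |S.ψ x - S.ψ y| * |(x' : ℝ) - y'| ≤
      Real.exp (L * ρ) * (|S.ψ x' - S.ψ y'| * |(x : ℝ) - y|)
    rw [h, h']
    calc _ = |deriv S.ψ ξ| * (|(x : ℝ) - y| * |(x' : ℝ) - y'|) := by ring
      _ ≤ Real.exp (L * ρ) * |deriv S.ψ ξ'| * (|(x : ℝ) - y| * |(x' : ℝ) - y'|) :=
          mul_le_mul_of_nonneg_right hquot (by positivity)
      _ = _ := by ring

theorem ordConnected_cylinder (w : ℕ → Fin r) (n : ℕ) :
    OrdConnected {y | ∀ i < n, S.ψ^[i] y ∈ S.interval (w i)} := by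
  induction n generalizing w with
  | zero => simpa using ordConnected_univ
  | succ n ih =>
    rw [ordConnected_iff_uIcc_subset]
    intro x hx y hy z hz
    have hx0 := hx 0 n.succ_pos
    have hy0 := hy 0 n.succ_pos
    have h := (ih fun i => w (i + 1)).uIcc_subset
      (show S.ψ x ∈ _ from fun i hi => hx (i + 1) (by omega))
      (show S.ψ y ∈ _ from fun i hi => hy (i + 1) (by omega)) (image_uIcc_subset hx0 hy0 hz)
    rintro (_ | i) hi
    · exact ordConnected_Icc.uIcc_subset hx0 hy0 hz
    · exact h i (by omega)

theorem exists_mem_K_of_itinerary (hreg : S.Regular) (n : ℕ) {w : ℕ → Fin r} {x : ℝ}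
    (hx : ∀ i < n + 1, S.ψ^[i] x ∈ S.interval (w i)) :
    ∃ y ∈ S.K, ∀ i < n + 1, S.ψ^[i] y ∈ S.interval (w i) := by
  induction n generalizing w x with
  | zero =>
    refine ⟨S.a (w 0), (hreg.1 _).1, fun i hi => ?_⟩
    obtain rfl : i = 0 := by omega
    exact left_mem_Icc.2 (S.lt _).le
  | succ n ih =>
    obtain ⟨y, hyK, hy⟩ := ih (w := fun i => w (i + 1)) (x := S.ψ x)
      fun i hi => hx (i + 1) (by omega)
    obtain ⟨u, hu, rfl⟩ := interval_subset_image (hx 0 (by omega)) (hx 1 (by omega))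
      (hy 0 (by omega))
    refine ⟨u, mem_K_of_map_mem (mem_Iset.2 ⟨_, hu⟩) hyK, ?_⟩
    rintro (_ | i) hi
    · exact hu
    · exact hy i (by omega)

theorem exists_itinerary {m : ℕ} {x : ℝ} (hx : ∀ i < m, S.ψ^[i] x ∈ S.Iset) (hm : 0 < m) :
    ∃ w : ℕ → Fin r, ∀ i < m, S.ψ^[i] x ∈ S.interval (w i) := by
  obtain ⟨j, -⟩ := mem_Iset.1 (hx 0 hm)
  have : Nonempty (Fin r) := ⟨j⟩
  choose! w hw using fun i (hi : i < m) => mem_Iset.1 (hx i hi)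
  exact ⟨w, hw⟩

theorem mem_Iset_of_mem_refined {m : ℕ} {I : Set ℝ} (hI : I ∈ S.refined m) {x : ℝ} (hx : x ∈ I)
    {i : ℕ} (hi : i < m) : S.ψ^[i] x ∈ S.Iset := by
  obtain ⟨j, z, -, rfl⟩ := hI
  exact mem_iInter.1 (connectedComponentIn_subset _ _ hx).1 ⟨i, hi⟩

theorem eq_of_mem_refined {m : ℕ} {I J : Set ℝ} (hI : I ∈ S.refined m) (hJ : J ∈ S.refined m)
    {x : ℝ} (hxI : x ∈ I) (hxJ : x ∈ J) : I = J := by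
  obtain ⟨i, y, -, rfl⟩ := hI
  obtain ⟨j, z, -, rfl⟩ := hJ
  obtain rfl : i = j := eq_of_mem_interval (connectedComponentIn_subset _ _ hxI).2
    (connectedComponentIn_subset _ _ hxJ).2
  exact (connectedComponentIn_eq hxI).trans (connectedComponentIn_eq hxJ).symm

theorem exists_cylinder_subset (hreg : S.Regular) {m : ℕ} (hm : 1 ≤ m) {J : Set ℝ}
    (hJ : J ∈ S.refined m) :
    ∃ x₀ : S.K, ∀ x : S.K, (∀ i < m, S.code (S.restrictK^[i] x) = S.code (S.restrictK^[i] x₀)) →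
      (x : ℝ) ∈ J := by
  obtain ⟨j, z, ⟨hz, hzj⟩, rfl⟩ := hJ
  obtain ⟨w, hw⟩ := exists_itinerary (fun i hi => mem_iInter.1 hz ⟨i, hi⟩) hm
  obtain rfl : w (m - 1) = j := eq_of_mem_interval (hw (m - 1) (by omega)) hzj
  obtain ⟨n, rfl⟩ : ∃ n, m = n + 1 := ⟨m - 1, by omega⟩
  obtain ⟨y, hyK, hy⟩ := exists_mem_K_of_itinerary hreg n hw
  refine ⟨⟨y, hyK⟩, fun x hx => ?_⟩
  have hsub := (ordConnected_cylinder (S := S) w (n + 1)).isPreconnected.subset_connectedComponentIn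
    hw (F := (⋂ i : Fin (n + 1), S.ψ^[(i : ℕ)] ⁻¹' S.Iset) ∩
      S.ψ^[n + 1 - 1] ⁻¹' Icc (S.a (w (n + 1 - 1))) (S.b (w (n + 1 - 1))))
    fun u hu => ⟨mem_iInter.2 fun i => mem_Iset.2 ⟨_, hu i i.2⟩, hu _ (by omega)⟩
  refine hsub fun i hi => ?_
  rw [← coe_restrictK_iterate, ← code_eq_iff, hx i hi, code_eq_iff, coe_restrictK_iterate]
  exact hy i hi

end CantorSystem

end RegularCantorSets

open MeasureTheory

/-- If `J ∈ 𝒫^m` is such that `𝒫^m \ {J}` is still a Markov partition for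
`ψ^m`, then the Cantor set `K̃ = ⋂ₙ ψ^{-nm}(⋃_{I ∈ 𝒫^m, I ≠ J} I)` has Hausdorff
dimension strictly smaller than that of `K`. -/
theorem dimH_lt_of_forget_interval {r : ℕ} (S : CantorSystem r) (s : ℕ∞) (hs : 1 < s)
    (hsmooth : ContDiffOn ℝ s S.ψ S.U) (hreg : S.Regular)
    (m : ℕ) (hm : 1 ≤ m) (J : Set ℝ) (hJ : J ∈ S.refined m)
    (hMP : IsMarkovPartition ((S.ψ)^[m]) (S.refined m \ {J})) :
    dimH (⋂ n : ℕ, ((S.ψ)^[m])^[n] ⁻¹' ⋃₀ (S.refined m \ {J})) < dimH S.K := by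
  have hψ : ContDiffOn ℝ 2 S.ψ S.U := by
    refine hsmooth.of_le ?_
    have : (2 : ℕ∞) ≤ s := by
      have := Order.add_one_le_of_lt hs
      rwa [one_add_one_eq_two] at this
    exact WithTop.coe_le_coe.2 this
  obtain ⟨Λ, C, hMarkov⟩ := CantorSystem.exists_isMarkovMap hψ hreg
  obtain ⟨x₀, hx₀⟩ := CantorSystem.exists_cylinder_subset hreg hm hJ
  have : CompactSpace S.K := isCompact_iff_compactSpace.1 CantorSystem.isCompact_K
  have : Nontrivial S.K :=
    ⟨⟨_, (hreg.1 (S.code x₀)).1⟩, ⟨_, (hreg.1 (S.code x₀)).2⟩,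
      fun h => (S.lt _).ne (congrArg Subtype.val h)⟩
  have hdim : dimH (Set.univ : Set S.K) = dimH S.K := by
    rw [← isometry_subtype_coe.dimH_image, Subtype.coe_image_univ]
  have hlt := (hMarkov.iterate hm).dimH_avoiding_lt
    (hdim ▸ (Real.dimH_ne_top S.K)) x₀
  rw [hdim, ← isometry_subtype_coe.dimH_image] at hlt
  refine (dimH_mono fun x hx => ?_).trans_lt hlt
  have hx' : ∀ n, ∃ I ∈ S.refined m \ {J}, S.ψ^[m * n] x ∈ I := fun n => by
    rw [Function.iterate_mul]
    exact Set.mem_iInter.1 hx n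
  have hxK : x ∈ S.K := Set.mem_iInter.2 fun i => by
    obtain ⟨I, hI, hxI⟩ := hx' (i / m)
    have := CantorSystem.mem_Iset_of_mem_refined hI.1 hxI (Nat.mod_lt i hm)
    rwa [← Function.iterate_add_apply, Nat.mod_add_div] at this
  refine ⟨⟨x, hxK⟩, fun n hn => ?_, rfl⟩
  obtain ⟨I, hI, hxI⟩ := hx' n
  refine hI.2 (CantorSystem.eq_of_mem_refined hI.1 hJ hxI ?_)
  have := hx₀ _ fun i hi => congrFun hn ⟨i, hi⟩
  rwa [← Function.iterate_mul, CantorSystem.coe_restrictK_iterate] at this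
end

section
/- Let ψ be an expanding map defined on a disjoint union I_1 ∪ … ∪ I_r of compact intervals, with Markov partition 𝒫 = {I_1, …, I_r}, defining the regular Cantor set K_ψ = ⋂_{n≥0} ψ^{−n}(I_1 ∪ … ∪ I_r). For each j let m_j = min{n ≥ 1 : ψ^n(I_j) contains at least two intervals of 𝒫}, assume each m_j is finite, and assume that for each j and each 1 ≤ i < m_j the set ψ^i(I_j) equals a single interval of 𝒫. Define T(ψ) on I_1 ∪ … ∪ I_r by T(ψ)|_{I_j} = ψ^{m_j}. Then ⋂_{n≥0} ψ^{−n}(I_1 ∪ … ∪ I_r) = ⋂_{n≥0} T(ψ)^{−n}(I_1 ∪ … ∪ I_r), i.e. K_ψ = K_{T(ψ)}. -/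
/-- Replacing `ψ` by the map `T(ψ)` which on each `Iⱼ` equals `ψ^{mⱼ}`,
where `mⱼ` is the first time the image of `Iⱼ` contains at least two intervals of the
partition (the earlier images being exactly single intervals of the partition), does not
change the maximal invariant set: `K_ψ = K_{T(ψ)}`. -/
theorem cantor_set_eq_of_accelerated_map
    {r : ℕ} (S : CantorSystem r) (hreg : S.Regular)
    (m : Fin r → ℕ) (hm1 : ∀ j, 1 ≤ m j)
    (htwo : ∀ j, ∃ k₁ k₂ : Fin r, k₁ ≠ k₂ ∧
      Set.Icc (S.a k₁) (S.b k₁) ⊆ (S.ψ)^[m j] '' Set.Icc (S.a j) (S.b j) ∧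
      Set.Icc (S.a k₂) (S.b k₂) ⊆ (S.ψ)^[m j] '' Set.Icc (S.a j) (S.b j))
    (hmin : ∀ j, ∀ n, 1 ≤ n → n < m j →
      ¬ ∃ k₁ k₂ : Fin r, k₁ ≠ k₂ ∧
        Set.Icc (S.a k₁) (S.b k₁) ⊆ (S.ψ)^[n] '' Set.Icc (S.a j) (S.b j) ∧
        Set.Icc (S.a k₂) (S.b k₂) ⊆ (S.ψ)^[n] '' Set.Icc (S.a j) (S.b j))
    (hsingle : ∀ j, ∀ i, 1 ≤ i → i < m j →
      ∃ k : Fin r, (S.ψ)^[i] '' Set.Icc (S.a j) (S.b j) = Set.Icc (S.a k) (S.b k))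
    (T : ℝ → ℝ) (hT : ∀ j, ∀ x ∈ Set.Icc (S.a j) (S.b j), T x = (S.ψ)^[m j] x) :
    (⋂ n : ℕ, (S.ψ)^[n] ⁻¹' S.Iset) = ⋂ n : ℕ, T^[n] ⁻¹' S.Iset := by
  ext x
  simp only [Set.mem_iInter, Set.mem_preimage]
  constructor
  · intro hx n
    suffices h : ∀ k, S.ψ^[k] (T^[n] x) ∈ S.Iset from h 0
    induction n with
    | zero => exact hx
    | succ n ih =>
      intro k
      obtain ⟨j, hj⟩ := Set.mem_iUnion.mp (ih 0)
      rw [Function.iterate_succ_apply', hT j (T^[n] x) hj, ← Function.iterate_add_apply]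
      exact ih _
  · intro hx n
    induction n using Nat.strong_induction_on generalizing x with
    | _ n ih =>
      obtain ⟨j, hj⟩ := Set.mem_iUnion.mp (hx 0)
      rcases Nat.eq_zero_or_pos n with rfl | hn
      · exact hx 0
      rcases lt_or_ge n (m j) with hlt | hge
      · obtain ⟨k, hk⟩ := hsingle j n hn hlt
        exact Set.mem_iUnion.mpr ⟨k, hk ▸ Set.mem_image_of_mem _ hj⟩
      · have hlast : S.ψ^[n - m j] (T x) ∈ S.Iset :=
          ih _ (Nat.sub_lt hn (hm1 j)) (T x) fun k => hx (k + 1)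
        rwa [hT j x hj, ← Function.iterate_add_apply, Nat.sub_add_cancel hge] at hlast
end

section
/- Let M be a metric space, φ : M → M a homeomorphism, f : M → ℝ continuous, Λ ⊆ M a compact set with φ(Λ) = Λ, and t ∈ ℝ. Then M_f(Λ) ∩ (−∞, t] ⊆ f(Λ_t), where Λ_t = ⋂_{n∈ℤ} φ^n(Λ ∩ f^{−1}((−∞, t])). In particular, L_f(Λ) ∩ (−∞, t] ⊆ f(Λ_t). -/
open Filter Topology

/-- The Lagrange value of `x` associated to `f` and `φ`:
`ℓ_{f,φ}(x) = limsup_{n → ∞} f(φⁿ(x))`. -/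
noncomputable def lagrangeValue {M : Type*} (φ : M → M) (f : M → ℝ) (x : M) : ℝ :=
  Filter.limsup (fun n : ℕ => f (φ^[n] x)) Filter.atTop

/-- The Markov value of `x` associated to `f` and an invertible map `φ`:
`m_{f,φ}(x) = sup_{n ∈ ℤ} f(φⁿ(x))`. -/
noncomputable def markovValue {M : Type*} (φ : M ≃ M) (f : M → ℝ) (x : M) : ℝ :=
  ⨆ n : ℤ, f ((φ ^ n) x)

/-- The Lagrange spectrum `L_f(Λ) = {ℓ_{f,φ}(x) : x ∈ Λ}` of a homeomorphism `φ`. -/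
noncomputable def lagrangeSpectrum {M : Type*} [TopologicalSpace M] (φ : M ≃ₜ M)
    (f : M → ℝ) (Λ : Set M) : Set ℝ :=
  (fun x => lagrangeValue (⇑φ) f x) '' Λ

/-- The Markov spectrum `M_f(Λ) = {m_{f,φ}(x) : x ∈ Λ}` of a homeomorphism `φ`. -/
noncomputable def markovSpectrum {M : Type*} [TopologicalSpace M] (φ : M ≃ₜ M)
    (f : M → ℝ) (Λ : Set M) : Set ℝ :=
  (fun x => markovValue φ.toEquiv f x) '' Λ

/-- `Λ_t = ⋂_{n ∈ ℤ} φⁿ(Λ ∩ f⁻¹((-∞, t]))`. -/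
def sublevelInvariant {M : Type*} [TopologicalSpace M] (φ : M ≃ₜ M)
    (f : M → ℝ) (Λ : Set M) (t : ℝ) : Set M :=
  ⋂ n : ℤ, (φ.toEquiv ^ n) '' (Λ ∩ f ⁻¹' Set.Iic t)

theorem mem_sublevelInvariant_iff {M : Type*} [TopologicalSpace M] {φ : M ≃ₜ M}
    {f : M → ℝ} {Λ : Set M} {t : ℝ} {y : M} :
    y ∈ sublevelInvariant φ f Λ t ↔
      ∀ n : ℤ, (φ.toEquiv ^ n) y ∈ Λ ∧ f ((φ.toEquiv ^ n) y) ≤ t := by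
  have key (n : ℤ) : y ∈ (φ.toEquiv ^ n) '' (Λ ∩ f ⁻¹' Set.Iic t) ↔
      (φ.toEquiv ^ (-n)) y ∈ Λ ∧ f ((φ.toEquiv ^ (-n)) y) ≤ t := by
    rw [Equiv.image_eq_preimage_symm, zpow_neg]
    rfl
  simp only [sublevelInvariant, Set.mem_iInter, key]
  exact ⟨fun h n => by simpa using h (-n), fun h n => h (-n)⟩

theorem Homeomorph.continuous_toEquiv_zpow {M : Type*} [TopologicalSpace M] (φ : M ≃ₜ M)
    (n : ℤ) : Continuous ⇑(φ.toEquiv ^ n) := by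
  have hpow (g : M ≃ₜ M) (k : ℕ) : Continuous ⇑(g.toEquiv ^ k) := by
    rw [← Equiv.Perm.iterate_eq_pow]
    exact g.continuous.iterate k
  obtain ⟨k, rfl | rfl⟩ := n.eq_nat_or_neg
  · simpa using hpow φ k
  · rw [zpow_neg, zpow_natCast, ← inv_pow]
    exact hpow φ.symm k

theorem zpow_apply_mem_of_image_eq {M : Type*} {σ : M ≃ M} {Λ : Set M} (hinv : σ '' Λ = Λ)
    {x : M} (hx : x ∈ Λ) (n : ℤ) : (σ ^ n) x ∈ Λ := by
  have hfwd (y : M) (hy : y ∈ Λ) : σ y ∈ Λ := hinv ▸ Set.mem_image_of_mem σ hy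
  have hbwd (y : M) (hy : y ∈ Λ) : σ⁻¹ y ∈ Λ := by
    rw [← hinv] at hy
    obtain ⟨z, hz, rfl⟩ := hy
    simpa using hz
  induction n with
  | zero => simpa using hx
  | succ n ih => simpa [add_comm (n : ℤ) 1, zpow_add] using hfwd _ ih
  | pred n ih =>
    rw [sub_eq_neg_add, zpow_add, zpow_neg_one]
    exact hbwd _ ih

theorem isClosed_sublevelInvariant {M : Type*} [TopologicalSpace M] (φ : M ≃ₜ M) {f : M → ℝ}
    (hf : Continuous f) {Λ : Set M} (hΛ : IsClosed Λ) (t : ℝ) :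
    IsClosed (sublevelInvariant φ f Λ t) := by
  have h : sublevelInvariant φ f Λ t =
      ⋂ n : ℤ, ⇑(φ.toEquiv ^ n) ⁻¹' (Λ ∩ f ⁻¹' Set.Iic t) := by
    ext y
    simp [mem_sublevelInvariant_iff]
  rw [h]
  exact isClosed_iInter fun n =>
    (hΛ.inter (isClosed_Iic.preimage hf)).preimage (φ.continuous_toEquiv_zpow n)

theorem isCompact_sublevelInvariant {M : Type*} [TopologicalSpace M] [T2Space M] (φ : M ≃ₜ M)
    {f : M → ℝ} (hf : Continuous f) {Λ : Set M} (hΛ : IsCompact Λ) (t : ℝ) :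
    IsCompact (sublevelInvariant φ f Λ t) :=
  hΛ.of_isClosed_subset (isClosed_sublevelInvariant φ hf hΛ.isClosed t)
    fun y hy => by simpa using (mem_sublevelInvariant_iff.1 hy 0).1

theorem mapClusterPt_limsup {α : Type*} {l : Filter α} [l.NeBot] {u : α → ℝ}
    (hub : l.IsBoundedUnder (· ≤ ·) u) (hlb : l.IsBoundedUnder (· ≥ ·) u) :
    MapClusterPt (limsup u l) l u := by
  rw [(nhds_basis_Ioo (limsup u l)).mapClusterPt_iff_frequently]
  rintro ⟨a, b⟩ ⟨ha, hb⟩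
  exact (frequently_lt_of_lt_limsup hlb.isCoboundedUnder_le ha).and_eventually
    (eventually_lt_of_limsup_lt hb hub)

theorem markovSpectrum_inter_Iic_subset {M : Type*} [TopologicalSpace M] [T2Space M]
    (φ : M ≃ₜ M) {f : M → ℝ} (hf : Continuous f) {Λ : Set M} (hΛ : IsCompact Λ)
    (hinv : φ '' Λ = Λ) (t : ℝ) :
    markovSpectrum φ f Λ ∩ Set.Iic t ⊆ f '' sublevelInvariant φ f Λ t := by
  rintro _ ⟨⟨x, hx, rfl⟩, hxt⟩
  have horbit (n : ℤ) : (φ.toEquiv ^ n) x ∈ Λ :=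
    zpow_apply_mem_of_image_eq (σ := φ.toEquiv) hinv hx n
  have hbdd : BddAbove (Set.range fun n : ℤ => f ((φ.toEquiv ^ n) x)) :=
    (hΛ.bddAbove_image hf.continuousOn).mono <|
      Set.range_subset_iff.2 fun n => Set.mem_image_of_mem f (horbit n)
  have hsub : Set.range (fun n : ℤ => f ((φ.toEquiv ^ n) x)) ⊆
      f '' sublevelInvariant φ f Λ t := by
    rintro _ ⟨n, rfl⟩
    refine Set.mem_image_of_mem f (mem_sublevelInvariant_iff.2 fun m => ?_)
    rw [← Equiv.Perm.mul_apply, ← zpow_add]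
    exact ⟨horbit _, (le_ciSup hbdd (m + n)).trans hxt⟩
  exact ((isCompact_sublevelInvariant φ hf hΛ t).image hf).isClosed.closure_subset_iff.2 hsub
    (csSup_mem_closure (Set.range_nonempty _) hbdd)

theorem lagrangeSpectrum_inter_Iic_subset {M : Type*} [TopologicalSpace M]
    (φ : M ≃ₜ M) {f : M → ℝ} (hf : Continuous f) {Λ : Set M} (hΛ : IsCompact Λ)
    (hinv : φ '' Λ = Λ) (t : ℝ) :
    lagrangeSpectrum φ f Λ ∩ Set.Iic t ⊆ f '' sublevelInvariant φ f Λ t := by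
  rintro _ ⟨⟨x, hx, rfl⟩, hxt⟩
  have hxt : limsup (fun n : ℕ => f (φ^[n] x)) atTop ≤ t := hxt
  have hmem (n : ℕ) : φ^[n] x ∈ Λ := by
    simpa [← Equiv.Perm.iterate_eq_pow] using
      zpow_apply_mem_of_image_eq (σ := φ.toEquiv) hinv hx n
  have hub : atTop.IsBoundedUnder (· ≤ ·) fun n : ℕ => f (φ^[n] x) :=
    BddAbove.isBoundedUnder_of_range <| (hΛ.bddAbove_image hf.continuousOn).mono <|
      Set.range_subset_iff.2 fun n => Set.mem_image_of_mem f (hmem n)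
  have hlb : atTop.IsBoundedUnder (· ≥ ·) fun n : ℕ => f (φ^[n] x) :=
    BddBelow.isBoundedUnder_of_range <| (hΛ.bddBelow_image hf.continuousOn).mono <|
      Set.range_subset_iff.2 fun n => Set.mem_image_of_mem f (hmem n)
  obtain ⟨U, hU, hlim⟩ := mapClusterPt_iff_ultrafilter.1 (mapClusterPt_limsup hub hlb)
  obtain ⟨y, hy, hUy⟩ := hΛ.ultrafilter_le_nhds (U.map fun n : ℕ => φ^[n] x)
    (le_principal_iff.2 (Ultrafilter.mem_map.2 (Filter.univ_mem' hmem)))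
  have hUy : Tendsto (fun n : ℕ => φ^[n] x) U (𝓝 y) := hUy
  refine ⟨y, mem_sublevelInvariant_iff.2 fun m =>
    ⟨zpow_apply_mem_of_image_eq (σ := φ.toEquiv) hinv hy m,
      le_of_forall_gt_imp_ge_of_dense fun s hs => ?_⟩,
    tendsto_nhds_unique ((hf.tendsto y).comp hUy) hlim⟩
  have hshift : Tendsto (fun n : ℕ => (m + n).toNat) atTop atTop :=
    tendsto_atTop.2 fun b => (eventually_ge_atTop (b + m.natAbs)).mono fun n hn => by omega
  have hlt : ∀ᶠ n : ℕ in atTop, f ((φ.toEquiv ^ m) (φ^[n] x)) < s := by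
    filter_upwards [hshift.eventually (eventually_lt_of_limsup_lt (hxt.trans_lt hs) hub),
      eventually_ge_atTop m.natAbs] with n hn hmn
    have heq : (φ.toEquiv ^ m) (φ^[n] x) = φ^[(m + n).toNat] x := by
      have hiter (k : ℕ) : φ^[k] x = (φ.toEquiv ^ (k : ℤ)) x := by
        rw [zpow_natCast, ← Equiv.Perm.iterate_eq_pow]
        rfl
      rw [hiter, hiter, ← Equiv.Perm.mul_apply, ← zpow_add, Int.toNat_of_nonneg (by omega)]
    rwa [heq]
  exact le_of_tendsto
    (((hf.comp (φ.continuous_toEquiv_zpow m)).tendsto y).comp hUy)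
    (hU (hlt.mono fun _ => le_of_lt))

/-- `M_f(Λ) ∩ (-∞, t] ⊆ f(Λ_t)`; in particular
`L_f(Λ) ∩ (-∞, t] ⊆ f(Λ_t)`. -/
theorem spectra_inter_Iic_subset_image_sublevel {M : Type*} [MetricSpace M]
    (φ : M ≃ₜ M) (f : M → ℝ) (hf : Continuous f)
    (Λ : Set M) (hΛ : IsCompact Λ) (hinv : (⇑φ) '' Λ = Λ) (t : ℝ) :
    markovSpectrum φ f Λ ∩ Set.Iic t ⊆ f '' sublevelInvariant φ f Λ t ∧
    lagrangeSpectrum φ f Λ ∩ Set.Iic t ⊆ f '' sublevelInvariant φ f Λ t := by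
  exact ⟨markovSpectrum_inter_Iic_subset φ hf hΛ hinv t,
    lagrangeSpectrum_inter_Iic_subset φ hf hΛ hinv t⟩
end

section
/- Let N ≥ 1 be a natural number and let x ∈ (0,1) be an irrational number with infinite simple continued fraction expansion x = [0; a_1, a_2, a_3, …] such that a_i ≤ N for every i ≥ 1 (i.e. x ∈ C(N)). Then x ≤ (−N + √(N² + 4N))/2, i.e. every element of C(N) is bounded above by B_N, the value of the periodic continued fraction [0; \overline{1, N}]. -/
open Filter Topology

/-- The `n`-th convergent of the simple continued fraction `[0; a 0, a 1, a 2, …]`: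
`cfConv a n = [0; a 0, …, a (n-1)]`. -/
noncomputable def cfConv : (ℕ → ℕ) → ℕ → ℝ
  | _, 0 => 0
  | a, n + 1 => 1 / ((a 0 : ℝ) + cfConv (fun i => a (i + 1)) n)

/-- Convergents of a continued fraction with natural partial denominators are nonnegative. -/
theorem cfConv_nonneg (a : ℕ → ℕ) (n : ℕ) : 0 ≤ cfConv a n := by
  induction n generalizing a with
  | zero => simp [cfConv]
  | succ n ih =>
    have := ih (fun i => a (i + 1))
    rw [cfConv]
    positivity

/-- If `B` is the nonnegative fixed point of `t ↦ [0; 1, N + t]`, then `B` bounds all the even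
convergents of continued fractions with partial denominators in `[1, N]`. -/
theorem cfConv_two_mul_le {N : ℕ} {B : ℝ} (hB : 0 ≤ B) (hfix : B * (N + B) = N)
    (a : ℕ → ℕ) (ha : ∀ i, 1 ≤ a i ∧ a i ≤ N) (k : ℕ) : cfConv a (2 * k) ≤ B := by
  induction k generalizing a with
  | zero => simpa [cfConv] using hB
  | succ k ih =>
    have hle := ih (fun i => a (i + 1 + 1)) fun i => ha _
    have hnn := cfConv_nonneg (fun i => a (i + 1 + 1)) (2 * k)
    have h0 : (1 : ℝ) ≤ a 0 := by exact_mod_cast (ha 0).1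
    have h1 : (1 : ℝ) ≤ a (0 + 1) := by exact_mod_cast (ha (0 + 1)).1
    have h1N : (a (0 + 1) : ℝ) ≤ N := by exact_mod_cast (ha (0 + 1)).2
    rw [Nat.mul_succ, cfConv, cfConv]
    set c := cfConv (fun i => a (i + 1 + 1)) (2 * k)
    have hNB : 0 < (N : ℝ) + B := by linarith
    calc 1 / ((a 0 : ℝ) + 1 / (a (0 + 1) + c)) ≤ 1 / (1 + 1 / (N + B)) := by
          gcongr
      _ = B := by
          field_simp
          linarith

/-- Every irrational `x ∈ (0,1)` whose continued fraction expansion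
`x = [0; a 0, a 1, …]` has all partial denominators `≤ N` satisfies
`x ≤ B_N = (-N + √(N² + 4N)) / 2`, the value of `[0; 1, N, 1, N, …]`. -/
theorem mem_C_le_B (N : ℕ) (hN : 1 ≤ N) (x : ℝ)
    (hx : x ∈ Set.Ioo (0 : ℝ) 1) (hirr : Irrational x)
    (a : ℕ → ℕ) (ha : ∀ i, 1 ≤ a i ∧ a i ≤ N)
    (hconv : Filter.Tendsto (cfConv a) Filter.atTop (nhds x)) :
    x ≤ (-(N : ℝ) + Real.sqrt ((N : ℝ) ^ 2 + 4 * N)) / 2 := by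
  have hNpos : (1 : ℝ) ≤ N := by exact_mod_cast hN
  have hsq : Real.sqrt ((N : ℝ) ^ 2 + 4 * N) ^ 2 = (N : ℝ) ^ 2 + 4 * N :=
    Real.sq_sqrt (by positivity)
  have hle : (N : ℝ) ≤ Real.sqrt ((N : ℝ) ^ 2 + 4 * N) :=
    Real.le_sqrt_of_sq_le (by linarith)
  have hsub : Filter.Tendsto (fun k : ℕ => 2 * k) Filter.atTop Filter.atTop :=
    Filter.tendsto_id.const_mul_atTop' two_pos
  refine le_of_tendsto' (hconv.comp hsub) fun k => ?_
  exact cfConv_two_mul_le (by linarith) (by linarith) a ha k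
end
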